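/- arXiv:math/0507090 — 4 statements merged into one kernel-verified Lean document; each statement's English description precedes it below -/
import Mathlib

section
/- Fix integers n ≥ 2 and r ≥ 1. The Higman–Thompson group G_{n,r} is coCF: there exists a finite set X of prefix-replacement permutations of Ω such that the subgroup of Equiv.Perm Ω generated by X has exactly the prefix-replacement permutations as its elements, and the language over the alphabet X × Bool consisting of all words whose evaluation in Equiv.Perm Ω is not the identity is a context-free language. -/
/-- The sequence beginning with the entries of `w` followed by `ω`. -/
def prepend {n : ℕ} (w : List (Fin n)) (ω : ℕ → Fin n) : ℕ → Fin n :=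
  fun i => if h : i < w.length then w.get ⟨i, h⟩ else ω (i - w.length)

/-- A permutation of `Ω = Fin r × (ℕ → Fin n)` is a prefix-replacement permutation if there
is a depth `k` such that it acts by replacing length-`k` prefixes. -/
def IsPrefixReplacement {n r : ℕ} (σ : Equiv.Perm (Fin r × (ℕ → Fin n))) : Prop :=
  ∃ k : ℕ, ∀ (q : Fin r) (w : List (Fin n)), w.length = k →
    ∃ (q' : Fin r) (w' : List (Fin n)), ∀ ω : ℕ → Fin n,
      σ (q, prepend w ω) = (q', prepend w' ω)

/-- Evaluation of a signed word over the alphabet `A` in the group `G`. -/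
def evalWord {G A : Type*} [Group G] (f : A → G) (w : List (A × Bool)) : G :=
  (w.map fun p => if p.2 then f p.1 else (f p.1)⁻¹).prod

/-- The point of the cone with address `p` that has tail `ω`. -/
def conePoint {n r : ℕ} (p : Fin r × List (Fin n)) (ω : ℕ → Fin n) : Fin r × (ℕ → Fin n) :=
  (p.1, prepend p.2 ω)

/-- The address obtained from `p` by appending `v`. -/
def extend {n r : ℕ} (p : Fin r × List (Fin n)) (v : List (Fin n)) : Fin r × List (Fin n) :=
  (p.1, p.2 ++ v)

section Addresses

variable {n r : ℕ}

@[simp] lemma prepend_nil (ω : ℕ → Fin n) : prepend [] ω = ω := by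
  funext i; simp [prepend]

@[simp] lemma prepend_cons_zero (a : Fin n) (w : List (Fin n)) (ω : ℕ → Fin n) :
    prepend (a :: w) ω 0 = a := by
  simp [prepend]

@[simp] lemma prepend_cons_succ (a : Fin n) (w : List (Fin n)) (ω : ℕ → Fin n) (i : ℕ) :
    prepend (a :: w) ω (i + 1) = prepend w ω i := by
  simp [prepend]

lemma prepend_cons_inj {a b : Fin n} {w w' : List (Fin n)} {ω ω' : ℕ → Fin n} :
    prepend (a :: w) ω = prepend (b :: w') ω' ↔ a = b ∧ prepend w ω = prepend w' ω' := by
  constructor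
  · intro h
    exact ⟨by simpa using congrFun h 0, funext fun i => by simpa using congrFun h (i + 1)⟩
  · rintro ⟨rfl, h⟩
    funext i
    cases i with
    | zero => simp
    | succ i => simpa using congrFun h i

lemma prepend_append (w w' : List (Fin n)) (ω : ℕ → Fin n) :
    prepend (w ++ w') ω = prepend w (prepend w' ω) := by
  induction w with
  | nil => simp
  | cons a w ih => rw [List.cons_append, prepend_cons_inj]; exact ⟨rfl, ih⟩

lemma exists_prefix_of_prepend_eq {w w' : List (Fin n)} {ω ω' : ℕ → Fin n}
    (h : prepend w ω = prepend w' ω') (hl : w.length ≤ w'.length) :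
    ∃ u, w' = w ++ u ∧ ω = prepend u ω' := by
  induction w generalizing w' with
  | nil => exact ⟨w', rfl, by simpa using h⟩
  | cons a w ih =>
    cases w' with
    | nil => simp at hl
    | cons b w' =>
      obtain ⟨rfl, h'⟩ := prepend_cons_inj.1 h
      obtain ⟨u, rfl, hu⟩ := ih h' (by simpa using hl)
      exact ⟨u, rfl, hu⟩

lemma exists_eq_prepend (ω : ℕ → Fin n) (k : ℕ) :
    ∃ (w : List (Fin n)) (ω' : ℕ → Fin n), w.length = k ∧ ω = prepend w ω' := by
  induction k generalizing ω with
  | zero => exact ⟨[], ω, rfl, by simp⟩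
  | succ k ih =>
    obtain ⟨w, ω', hw, h⟩ := ih fun i => ω (i + 1)
    refine ⟨ω 0 :: w, ω', by simp [hw], funext fun i => ?_⟩
    cases i with
    | zero => simp
    | succ i => simpa using congrFun h i

@[simp] lemma extend_fst (p : Fin r × List (Fin n)) (v : List (Fin n)) :
    (extend p v).1 = p.1 := rfl

@[simp] lemma extend_snd (p : Fin r × List (Fin n)) (v : List (Fin n)) :
    (extend p v).2 = p.2 ++ v := rfl

@[simp] lemma extend_nil (p : Fin r × List (Fin n)) : extend p [] = p := by simp [extend]

lemma extend_append (p : Fin r × List (Fin n)) (v v' : List (Fin n)) :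
    extend p (v ++ v') = extend (extend p v) v' := by simp [extend]

lemma conePoint_extend (p : Fin r × List (Fin n)) (v : List (Fin n)) (ω : ℕ → Fin n) :
    conePoint (extend p v) ω = conePoint p (prepend v ω) := by
  simp [conePoint, extend, prepend_append]

lemma exists_extend_of_extend_eq {a c : Fin r × List (Fin n)} {t v : List (Fin n)}
    (h : extend a t = extend c v) (hl : c.2.length ≤ a.2.length) :
    ∃ s, a = extend c s ∧ v = s ++ t := by
  obtain ⟨q, a⟩ := a
  obtain ⟨q', c⟩ := c
  simp only [extend, Prod.mk.injEq] at h
  obtain ⟨rfl, h⟩ := h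
  rcases List.append_eq_append_iff.1 h with ⟨s, rfl, rfl⟩ | ⟨s, rfl, rfl⟩
  · have : s = [] := by simpa using hl
    subst this
    exact ⟨[], by simp, by simp⟩
  · exact ⟨s, rfl, rfl⟩

lemma exists_extend_of_conePoint_eq {p p' : Fin r × List (Fin n)} {ω ω' : ℕ → Fin n}
    (h : conePoint p ω = conePoint p' ω') (hl : p.2.length ≤ p'.2.length) :
    ∃ u, p' = extend p u ∧ ω = prepend u ω' := by
  simp only [conePoint, Prod.mk.injEq] at h
  obtain ⟨u, hu, hω⟩ := exists_prefix_of_prepend_eq h.2 hl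
  exact ⟨u, Prod.ext h.1.symm hu, hω⟩

lemma exists_eq_conePoint (x : Fin r × (ℕ → Fin n)) (k : ℕ) :
    ∃ (p : Fin r × List (Fin n)) (ω : ℕ → Fin n), p.2.length = k ∧ x = conePoint p ω := by
  obtain ⟨w, ω, hw, h⟩ := exists_eq_prepend x.2 k
  exact ⟨(x.1, w), ω, hw, Prod.ext rfl h⟩

lemma finite_setOf_length_le (B : ℕ) : {p : Fin r × List (Fin n) | p.2.length ≤ B}.Finite :=
  (Set.finite_univ.prod (List.finite_length_le (Fin n) B)).subset fun _ hp => ⟨trivial, hp⟩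

/-- Two finite sequences differ at some common position. -/
inductive Differ : List (Fin n) → List (Fin n) → Prop
  | head {x y : Fin n} (h : x ≠ y) (v w : List (Fin n)) : Differ (x :: v) (y :: w)
  | cons (x : Fin n) {v w : List (Fin n)} (h : Differ v w) : Differ (x :: v) (x :: w)

/-- Two addresses are apart if their cones are disjoint. -/
def Apart (p p' : Fin r × List (Fin n)) : Prop := p.1 ≠ p'.1 ∨ Differ p.2 p'.2

lemma Differ.prepend_ne {v v' : List (Fin n)} (h : Differ v v') (ω ω' : ℕ → Fin n) :
    prepend v ω ≠ prepend v' ω' := by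
  induction h with
  | head h v v' => exact fun e => h (prepend_cons_inj.1 e).1
  | cons x _ ih => exact fun e => ih (prepend_cons_inj.1 e).2

lemma Differ.append_left (a : List (Fin n)) {v v' : List (Fin n)} (h : Differ v v') :
    Differ (a ++ v) (a ++ v') := by
  induction a with
  | nil => exact h
  | cons x a ih => exact ih.cons x

lemma Apart.conePoint_ne {p p' : Fin r × List (Fin n)} (h : Apart p p') (ω ω' : ℕ → Fin n) :
    conePoint p ω ≠ conePoint p' ω' := by
  intro e
  simp only [conePoint, Prod.mk.injEq] at e
  exact h.elim (fun h => h e.1) fun h => h.prepend_ne ω ω' e.2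

lemma Apart.ne {p p' : Fin r × List (Fin n)} (h : Apart p p') : p ≠ p' := by
  rintro rfl
  rcases h with h | h
  · exact h rfl
  · generalize hv : p.2 = v at h
    clear hv
    induction v with
    | nil => cases h
    | cons x v ih =>
      cases h with
      | head h => exact h rfl
      | cons _ h => exact ih h

lemma exists_differ_append [Nontrivial (Fin n)] {v v' : List (Fin n)} (h : v ≠ v') :
    ∃ x, Differ (v ++ [x]) (v' ++ [x]) := by
  induction v generalizing v' with
  | nil =>
    cases v' with
    | nil => exact absurd rfl h
    | cons y v' =>
      obtain ⟨x, hx⟩ := exists_ne y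
      exact ⟨x, .head hx _ _⟩
  | cons a v ih =>
    cases v' with
    | nil =>
      obtain ⟨x, hx⟩ := exists_ne a
      exact ⟨x, .head hx.symm _ _⟩
    | cons b v' =>
      by_cases hab : a = b
      · subst hab
        obtain ⟨x, hx⟩ := ih (v' := v') fun e => h (by rw [e])
        exact ⟨x, hx.cons a⟩
      · exact ⟨a, .head hab _ _⟩

lemma exists_apart_extend [Nontrivial (Fin n)] {p p' : Fin r × List (Fin n)} (h : p ≠ p') :
    ∃ x, Apart (extend p [x]) (extend p' [x]) := by
  by_cases h1 : p.1 = p'.1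
  · obtain ⟨x, hx⟩ := exists_differ_append (v := p.2) (v' := p'.2) fun e => h (Prod.ext h1 e)
    exact ⟨x, .inr hx⟩
  · obtain ⟨x, -⟩ := exists_pair_ne (Fin n)
    exact ⟨x, .inl h1⟩

end Addresses

section Depth

variable {n r : ℕ}

/-- A permutation has depth `k` if it acts by replacing the prefixes of length `k`. -/
def HasDepth (σ : Equiv.Perm (Fin r × (ℕ → Fin n))) (k : ℕ) : Prop :=
  ∀ p : Fin r × List (Fin n), p.2.length = k →
    ∃ p' : Fin r × List (Fin n), ∀ ω, σ (conePoint p ω) = conePoint p' ω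

lemma isPrefixReplacement_iff {σ : Equiv.Perm (Fin r × (ℕ → Fin n))} :
    IsPrefixReplacement σ ↔ ∃ k, HasDepth σ k := by
  simp [IsPrefixReplacement, HasDepth, conePoint, Prod.exists, Prod.forall]

lemma HasDepth.exists_of_le {σ : Equiv.Perm (Fin r × (ℕ → Fin n))} {k : ℕ} (h : HasDepth σ k)
    {p : Fin r × List (Fin n)} (hp : k ≤ p.2.length) :
    ∃ p' : Fin r × List (Fin n), ∀ ω, σ (conePoint p ω) = conePoint p' ω := by
  obtain ⟨p', hp'⟩ := h (p.1, p.2.take k) (by simpa using hp)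
  refine ⟨extend p' (p.2.drop k), fun ω => ?_⟩
  rw [conePoint_extend, ← hp', ← conePoint_extend]
  simp [extend]

lemma HasDepth.mono {σ : Equiv.Perm (Fin r × (ℕ → Fin n))} {k l : ℕ} (h : HasDepth σ k)
    (hkl : k ≤ l) : HasDepth σ l := fun _ hp => h.exists_of_le (by omega)

end Depth

/-- `Run Δ w u u'` says that reading `w` can turn the address `u` into `u'` when reading a letter
`l` replaces a prefix `c` by `c'` for some `(l, c, c') ∈ Δ`. -/
def Run {α : Type*} {n r : ℕ}
    (Δ : Set (α × (Fin r × List (Fin n)) × (Fin r × List (Fin n)))) :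
    List α → Fin r × List (Fin n) → Fin r × List (Fin n) → Prop
  | [], u, u' => u = u'
  | l :: w, u, u' => ∃ c c' v, (l, c, c') ∈ Δ ∧ u = extend c v ∧ Run Δ w (extend c' v) u'

section Runs

variable {α : Type*} {n r : ℕ} {Δ : Set (α × (Fin r × List (Fin n)) × (Fin r × List (Fin n)))}
  {w : List α}

lemma run_append {w₁ w₂ : List α} {u u' : Fin r × List (Fin n)} :
    Run Δ (w₁ ++ w₂) u u' ↔ ∃ e, Run Δ w₁ u e ∧ Run Δ w₂ e u' := by
  induction w₁ generalizing u with
  | nil => simp [Run]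
  | cons l w₁ ih =>
    simp only [List.cons_append, Run, ih]
    constructor
    · rintro ⟨c, c', v, h, hu, e, h1, h2⟩
      exact ⟨e, ⟨c, c', v, h, hu, h1⟩, h2⟩
    · rintro ⟨e, ⟨c, c', v, h, hu, h1⟩, h2⟩
      exact ⟨c, c', v, h, hu, e, h1, h2⟩

lemma Run.extend_both {u u' : Fin r × List (Fin n)} (h : Run Δ w u u') (v : List (Fin n)) :
    Run Δ w (extend u v) (extend u' v) := by
  induction w generalizing u with
  | nil => exact congrArg (extend · v) h
  | cons l w ih =>
    obtain ⟨c, d, s, hl, rfl, h⟩ := h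
    exact ⟨c, d, s ++ v, hl, (extend_append ..).symm, by rw [extend_append]; exact ih h⟩

/-- A run that consumes a long top part first makes that part short. -/
lemma Run.exists_pop {L : ℕ} (hΔ : ∀ t ∈ Δ, t.2.1.2.length ≤ L)
    {a d : Fin r × List (Fin n)} {t : List (Fin n)} (h : Run Δ w (extend a t) d)
    (hd : d.2.length ≤ L + t.length) :
    ∃ w₁ w₂ e, w = w₁ ++ w₂ ∧ Run Δ w₁ a e ∧ Run Δ w₂ (extend e t) d ∧
      e.2.length ≤ L := by
  by_cases ha : a.2.length ≤ L
  · exact ⟨[], w, a, rfl, rfl, h, ha⟩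
  induction w generalizing a with
  | nil =>
    obtain rfl : extend a t = d := h
    simp at hd
    omega
  | cons l w ih =>
    obtain ⟨c, c', v, hl, hu, h⟩ := h
    have hc : c.2.length ≤ L := hΔ _ hl
    obtain ⟨s, rfl, rfl⟩ := exists_extend_of_extend_eq hu (by omega)
    rw [extend_append] at h
    by_cases hs : (extend c' s).2.length ≤ L
    · exact ⟨[l], w, _, rfl, ⟨c, c', s, hl, rfl, rfl⟩, h, hs⟩
    · obtain ⟨w₁, w₂, e, rfl, h1, h2, he⟩ := ih h hs
      exact ⟨l :: w₁, w₂, e, rfl, ⟨c, c', s, hl, rfl, h1⟩, h2, he⟩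

/-- A run that builds a long top part does so, at the end, from a short one. -/
lemma Run.exists_push {L : ℕ} (hΔ : ∀ t ∈ Δ, t.2.2.2.length ≤ L)
    {a d : Fin r × List (Fin n)} {t : List (Fin n)} (h : Run Δ w d (extend a t))
    (hd : d.2.length ≤ L + t.length) :
    ∃ w₁ w₂ e, w = w₁ ++ w₂ ∧ Run Δ w₁ d (extend e t) ∧ Run Δ w₂ e a ∧
      e.2.length ≤ L := by
  by_cases ha : a.2.length ≤ L
  · exact ⟨w, [], a, by simp, h, rfl, ha⟩
  induction w using List.reverseRecOn generalizing a with
  | nil =>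
    obtain rfl : d = extend a t := h
    simp at hd
    omega
  | append_singleton w l ih =>
    obtain ⟨f, h, c, c', v, hl, rfl, hu⟩ := run_append.1 h
    have hc : c'.2.length ≤ L := hΔ _ hl
    obtain ⟨s, rfl, rfl⟩ := exists_extend_of_extend_eq (Eq.symm hu) (by omega)
    rw [extend_append] at h
    by_cases hs : (extend c s).2.length ≤ L
    · exact ⟨w, [l], _, rfl, h, ⟨c, c', s, hl, rfl, rfl⟩, hs⟩
    · obtain ⟨w₁, w₂, e, rfl, h1, h2, he⟩ := ih h hs
      exact ⟨w₁, w₂ ++ [l], e, by simp, h1, run_append.2 ⟨_, h2, c, c', s, hl, rfl, rfl⟩, he⟩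

lemma Run.split_or_strip {L : ℕ} (hΔ : ∀ t ∈ Δ, t.2.1.2.length ≤ L)
    {u u' : Fin r × List (Fin n)} (h : Run Δ w u u') :
    (∃ w₁ w₂ d, w = w₁ ++ w₂ ∧ Run Δ w₁ u d ∧ Run Δ w₂ d u' ∧ d.2.length ≤ L) ∨
      ∃ y y' x, u = extend y [x] ∧ u' = extend y' [x] ∧ Run Δ w y y' := by
  by_cases hu : u.2.length ≤ L
  · exact .inl ⟨[], w, u, rfl, rfl, h, hu⟩
  induction w generalizing u with
  | nil =>
    obtain rfl : u = u' := h
    obtain ⟨q, u⟩ := u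
    rcases List.eq_nil_or_concat u with rfl | ⟨y, x, rfl⟩
    · simp at hu
    · exact .inr ⟨(q, y), (q, y), x, by simp [extend], by simp [extend], rfl⟩
  | cons l w ih =>
    obtain ⟨c, c', v, hl, rfl, h⟩ := h
    have hc : c.2.length ≤ L := hΔ _ hl
    by_cases hs : (extend c' v).2.length ≤ L
    · exact .inl ⟨[l], w, _, rfl, ⟨c, c', v, hl, rfl, rfl⟩, h, hs⟩
    rcases ih h hs with ⟨w₁, w₂, d, rfl, h1, h2, hd⟩ | ⟨y, y', x, hy, rfl, h'⟩
    · exact .inl ⟨l :: w₁, w₂, d, rfl, ⟨c, c', v, hl, rfl, h1⟩, h2, hd⟩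
    · rcases List.eq_nil_or_concat v with rfl | ⟨v, z, rfl⟩
      · simp at hu
        omega
      · rw [List.concat_eq_append, extend_append] at hy
        obtain ⟨s, rfl, hs⟩ := exists_extend_of_extend_eq hy.symm (by
          have := congrArg (fun p => p.2.length) hy
          simp at this
          simp
          omega)
        cases s with
        | cons a s => simp at hs
        | nil =>
          obtain rfl : z = x := by simpa using hs
          refine .inr ⟨extend c v, y', z, ?_, rfl, c, c', v, hl, rfl, by simpa using h'⟩
          rw [List.concat_eq_append, extend_append]

lemma Run.exists_short {L : ℕ} (hΔ : ∀ t ∈ Δ, t.2.1.2.length ≤ L)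
    {u u' : Fin r × List (Fin n)} (h : Run Δ w u u') (hne : u ≠ u') :
    ∃ w₁ w₂ p d p', w = w₁ ++ w₂ ∧ Run Δ w₁ p d ∧ Run Δ w₂ d p' ∧ d.2.length ≤ L ∧ p ≠ p' := by
  induction hN : u.2.length generalizing u u' with
  | zero => exact ⟨[], w, u, u, u', rfl, rfl, h, by omega, hne⟩
  | succ N ih =>
    rcases h.split_or_strip hΔ with ⟨w₁, w₂, d, rfl, h1, h2, hd⟩ | ⟨y, y', x, rfl, rfl, h'⟩
    · exact ⟨w₁, w₂, u, d, u', rfl, h1, h2, hd, hne⟩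
    · exact ih h' (fun e => hne (by rw [e])) (by simpa using hN)

lemma exists_run {K : ℕ} (hΔ : ∀ l c, c.2.length = K → ∃ c', (l, c, c') ∈ Δ) (w : List α)
    (u : Fin r × List (Fin n)) (hu : K * w.length ≤ u.2.length) : ∃ u', Run Δ w u u' := by
  induction w generalizing u with
  | nil => exact ⟨u, rfl⟩
  | cons l w ih =>
    rw [List.length_cons, mul_add, mul_one] at hu
    obtain ⟨c', hc⟩ := hΔ l (u.1, u.2.take K) (by simp; omega)
    obtain ⟨u', h⟩ := ih (extend c' (u.2.drop K)) (by simp; omega)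
    exact ⟨u', _, c', u.2.drop K, hc, by simp [extend], h⟩

end Runs

section Grammars

variable {α : Type*}

/-- The language of a sentential form when each nonterminal `A` is interpreted as `I A`. -/
def interpret {N : Type} (I : N → Language α) (u : List (Symbol α N)) : Language α :=
  (u.map fun | .terminal t => {[t]} | .nonterminal A => I A).prod

lemma interpret_append {N : Type} (I : N → Language α) (u v : List (Symbol α N)) :
    interpret I (u ++ v) = interpret I u * interpret I v := by
  simp [interpret]

lemma interpret_nil {N : Type} (I : N → Language α) : interpret I [] = 1 := rfl

lemma mem_interpret_nonterminal_cons {N : Type} {I : N → Language α} {A : N}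
    {u : List (Symbol α N)} {w : List α} :
    w ∈ interpret I (.nonterminal A :: u) ↔ ∃ a ∈ I A, ∃ b ∈ interpret I u, a ++ b = w := by
  simp [interpret, Language.mem_mul]

lemma mem_interpret_terminal_cons {N : Type} {I : N → Language α} {l : α}
    {u : List (Symbol α N)} {w : List α} :
    w ∈ interpret I (.terminal l :: u) ↔ ∃ b ∈ interpret I u, l :: b = w := by
  have : ∀ a : List α, a ∈ ({[l]} : Language α) ↔ a = [l] := fun a => Set.mem_singleton_iff
  simp [interpret, Language.mem_mul, this]

lemma mem_interpret_nonterminal {N : Type} {I : N → Language α} {A : N} {w : List α} :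
    w ∈ interpret I [.nonterminal A] ↔ w ∈ I A := by
  simp [interpret]

lemma interpret_terminals {N : Type} (I : N → Language α) (w : List α) :
    w ∈ interpret I (w.map .terminal) := by
  induction w with
  | nil => exact Language.nil_mem_one
  | cons l w ih => exact mem_interpret_terminal_cons.2 ⟨w, ih, rfl⟩

lemma interpret_le_of_derives (g : ContextFreeGrammar α) (I : g.NT → Language α)
    (h : ∀ ρ ∈ g.rules, interpret I ρ.output ≤ I ρ.input) {u v : List (Symbol α g.NT)}
    (huv : g.Derives u v) : interpret I v ≤ interpret I u := by
  induction huv with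
  | refl => exact le_rfl
  | tail _ hp ih =>
    obtain ⟨ρ, hρ, hr⟩ := hp
    obtain ⟨p, q, rfl, rfl⟩ := hr.exists_parts
    refine le_trans ?_ ih
    have hA : interpret I [Symbol.nonterminal ρ.input] = I ρ.input := by simp [interpret]
    simp only [interpret_append, hA]
    gcongr
    exact h ρ hρ

lemma derives_of_rule {g : ContextFreeGrammar α} {A : g.NT} {u v : List (Symbol α g.NT)}
    (h : ⟨A, u⟩ ∈ g.rules) (huv : g.Derives u v) : g.Derives [.nonterminal A] v :=
  ContextFreeGrammar.Produces.trans_derives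
    ⟨_, h, ContextFreeRule.Rewrites.input_output⟩ huv

lemma derives_append {g : ContextFreeGrammar α} {u u' v v' : List (Symbol α g.NT)}
    (h : g.Derives u v) (h' : g.Derives u' v') : g.Derives (u ++ u') (v ++ v') :=
  (h.append_right u').trans (h'.append_left v)

end Grammars

/-- Nonterminals of the grammar for the runs that change the address: `start`, the runs from `a`
to `b` (`run a b`), the runs from an extension of `a` to an extension of `b` (`free a b`), and
those for which the extensions differ (`differ a b`). -/
inductive RunSymbol (n r : ℕ) : Type
  | start
  | run (a b : Fin r × List (Fin n))
  | free (a b : Fin r × List (Fin n))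
  | differ (a b : Fin r × List (Fin n))

/-- The runs that a nonterminal stands for. -/
def runLanguage {α : Type*} {n r : ℕ}
    (Δ : Set (α × (Fin r × List (Fin n)) × (Fin r × List (Fin n)))) :
    RunSymbol n r → Language α
  | .start => {w | ∃ u u', u ≠ u' ∧ Run Δ w u u'}
  | .run a b => {w | Run Δ w a b}
  | .free a b => {w | ∃ s t, Run Δ w (extend a s) (extend b t)}
  | .differ a b => {w | ∃ s t, Differ s t ∧ Run Δ w (extend a s) (extend b t)}

/-- The rules of the grammar for the runs that change the address. -/
inductive RunRule {α : Type*} {n r : ℕ}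
    (Δ : Set (α × (Fin r × List (Fin n)) × (Fin r × List (Fin n)))) :
    ContextFreeRule α (RunSymbol n r) → Prop
  | run_nil (a) : RunRule Δ ⟨.run a a, []⟩
  | run_cons (l c c' v e b) (h : (l, c, c') ∈ Δ) : RunRule Δ ⟨.run (extend c v) b,
      [.terminal l, .nonterminal (.run c' e), .nonterminal (.run (extend e v) b)]⟩
  | free_run (a b) : RunRule Δ ⟨.free a b, [.nonterminal (.run a b)]⟩
  | free_left (a b e x) : RunRule Δ ⟨.free a b,
      [.nonterminal (.run (extend a [x]) e), .nonterminal (.free e b)]⟩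
  | free_right (a b e x) : RunRule Δ ⟨.free a b,
      [.nonterminal (.free a e), .nonterminal (.run e (extend b [x]))]⟩
  | differ_same (a b e e' x) : RunRule Δ ⟨.differ a b, [.nonterminal (.run (extend a [x]) e),
      .nonterminal (.differ e e'), .nonterminal (.run e' (extend b [x]))]⟩
  | differ_ne (a b e e' x y) (h : x ≠ y) : RunRule Δ ⟨.differ a b,
      [.nonterminal (.run (extend a [x]) e), .nonterminal (.free e e'),
        .nonterminal (.run e' (extend b [y]))]⟩
  | start_same (q) : RunRule Δ ⟨.start, [.nonterminal (.differ (q, []) (q, []))]⟩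
  | start_ne (q q') (h : q ≠ q') : RunRule Δ ⟨.start, [.nonterminal (.free (q, []) (q', []))]⟩

section RunGrammar

variable {α : Type*} {n r : ℕ} {Δ : Set (α × (Fin r × List (Fin n)) × (Fin r × List (Fin n)))}

lemma RunRule.sound {ρ : ContextFreeRule α (RunSymbol n r)} (h : RunRule Δ ρ)
    {w : List α} (hw : w ∈ interpret (runLanguage Δ) ρ.output) : w ∈ runLanguage Δ ρ.input := by
  have cons_extend : ∀ (a : Fin r × List (Fin n)) (x v), extend a (x :: v) =
      extend (extend a [x]) v := fun a x v => extend_append a [x] v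
  cases h with
  | run_nil a =>
    obtain rfl : w = [] := hw
    exact rfl
  | run_cons l c c' v e b h =>
    simp only [mem_interpret_terminal_cons, mem_interpret_nonterminal_cons,
      interpret_nil, Language.mem_one] at hw
    obtain ⟨_, ⟨w₁, h1, _, ⟨w₂, h2, _, rfl, rfl⟩, rfl⟩, rfl⟩ := hw
    rw [List.append_nil]
    exact ⟨c, c', v, h, rfl, run_append.2 ⟨_, Run.extend_both h1 v, h2⟩⟩
  | free_run a b =>
    rw [mem_interpret_nonterminal] at hw
    refine ⟨[], [], ?_⟩
    rw [extend_nil, extend_nil]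
    exact hw
  | free_left a b e x =>
    simp only [mem_interpret_nonterminal_cons, interpret_nil, Language.mem_one] at hw
    obtain ⟨w₁, h1, _, ⟨w₂, ⟨v, v', h2⟩, _, rfl, rfl⟩, rfl⟩ := hw
    rw [List.append_nil]
    refine ⟨x :: v, v', ?_⟩
    rw [cons_extend]
    exact run_append.2 ⟨_, Run.extend_both h1 v, h2⟩
  | free_right a b e x =>
    simp only [mem_interpret_nonterminal_cons, interpret_nil, Language.mem_one] at hw
    obtain ⟨w₁, ⟨v, v', h1⟩, _, ⟨w₂, h2, _, rfl, rfl⟩, rfl⟩ := hw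
    rw [List.append_nil]
    refine ⟨v, x :: v', ?_⟩
    rw [cons_extend]
    exact run_append.2 ⟨_, h1, Run.extend_both h2 v'⟩
  | differ_same a b e e' x =>
    simp only [mem_interpret_nonterminal_cons, interpret_nil, Language.mem_one] at hw
    obtain ⟨w₁, h1, _, ⟨w₂, ⟨v, v', hv, h2⟩, _, ⟨w₃, h3, _, rfl, rfl⟩, rfl⟩, rfl⟩ := hw
    rw [List.append_nil]
    refine ⟨x :: v, x :: v', hv.cons x, ?_⟩
    rw [cons_extend a, cons_extend b]
    exact run_append.2 ⟨_, Run.extend_both h1 v, run_append.2 ⟨_, h2, Run.extend_both h3 v'⟩⟩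
  | differ_ne a b e e' x y h =>
    simp only [mem_interpret_nonterminal_cons, interpret_nil, Language.mem_one] at hw
    obtain ⟨w₁, h1, _, ⟨w₂, ⟨v, v', h2⟩, _, ⟨w₃, h3, _, rfl, rfl⟩, rfl⟩, rfl⟩ := hw
    rw [List.append_nil]
    refine ⟨x :: v, y :: v', .head h v v', ?_⟩
    rw [cons_extend a, cons_extend b]
    exact run_append.2 ⟨_, Run.extend_both h1 v, run_append.2 ⟨_, h2, Run.extend_both h3 v'⟩⟩
  | start_same q =>
    rw [mem_interpret_nonterminal] at hw
    obtain ⟨v, v', hv, h⟩ := hw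
    exact ⟨_, _, Apart.ne (.inr (hv.append_left [])), h⟩
  | start_ne q q' hq =>
    rw [mem_interpret_nonterminal] at hw
    obtain ⟨v, v', h⟩ := hw
    exact ⟨_, _, Apart.ne (.inl hq), h⟩

/-- A nonterminal all of whose addresses have length at most `B`. -/
def RunSymbol.IsShort (B : ℕ) : RunSymbol n r → Prop
  | .start => True
  | .run a b | .free a b | .differ a b => a.2.length ≤ B ∧ b.2.length ≤ B

lemma RunSymbol.finite_isShort (B : ℕ) : {A : RunSymbol n r | A.IsShort B}.Finite := by
  have h := (finite_setOf_length_le (n := n) (r := r) B).prod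
    (finite_setOf_length_le (n := n) (r := r) B)
  refine ((((h.image fun p => RunSymbol.run p.1 p.2).union
    (h.image fun p => RunSymbol.free p.1 p.2)).union
    (h.image fun p => RunSymbol.differ p.1 p.2)).insert .start).subset ?_
  rintro (_ | ⟨a, b⟩ | ⟨a, b⟩ | ⟨a, b⟩) hA
  · exact .inl rfl
  · exact .inr (.inl (.inl ⟨(a, b), hA, rfl⟩))
  · exact .inr (.inl (.inr ⟨(a, b), hA, rfl⟩))
  · exact .inr (.inr ⟨(a, b), hA, rfl⟩)

/-- The symbols that may occur in the grammar with addresses of length at most `B`. -/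
def IsShortSymbol (Δ : Set (α × (Fin r × List (Fin n)) × (Fin r × List (Fin n)))) (B : ℕ) :
    Symbol α (RunSymbol n r) → Prop
  | .terminal l => ∃ c c', (l, c, c') ∈ Δ
  | .nonterminal A => A.IsShort B

lemma finite_isShortSymbol (hΔ : Δ.Finite) (B : ℕ) : {s | IsShortSymbol Δ B s}.Finite := by
  refine ((hΔ.image fun t => Symbol.terminal t.1).union
    ((RunSymbol.finite_isShort B).image Symbol.nonterminal)).subset ?_
  rintro (l | A) hs
  · obtain ⟨c, c', h⟩ := hs
    exact .inl ⟨_, h, rfl⟩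
  · exact .inr ⟨A, hs, rfl⟩

/-- The rules that involve only addresses of length at most `B`. -/
def shortRules (Δ : Set (α × (Fin r × List (Fin n)) × (Fin r × List (Fin n)))) (B : ℕ) :
    Set (ContextFreeRule α (RunSymbol n r)) :=
  {ρ | RunRule Δ ρ ∧ ρ.input.IsShort B ∧ ∀ s ∈ ρ.output, IsShortSymbol Δ B s}

lemma finite_shortRules (hΔ : Δ.Finite) (B : ℕ) : (shortRules Δ B).Finite := by
  have : Finite {s | IsShortSymbol Δ B s} := (finite_isShortSymbol hΔ B).to_subtype
  have hl := (List.finite_length_le {s | IsShortSymbol Δ B s} 3).image (List.map Subtype.val)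
  refine (((RunSymbol.finite_isShort B).prod hl).image
    fun p => (⟨p.1, p.2⟩ : ContextFreeRule α (RunSymbol n r))).subset ?_
  rintro ⟨A, γ⟩ ⟨hρ, hA, hγ⟩
  refine ⟨(A, γ), ⟨hA, γ.attach.map fun s => ⟨s.1, hγ _ s.2⟩, ?_, ?_⟩, rfl⟩
  · have : γ.length ≤ 3 := by cases hρ <;> simp
    change (List.map _ _).length ≤ 3
    rwa [List.length_map, List.length_attach]
  · simp

/-- The grammar for the runs that change the address. -/
noncomputable def runGrammar (hΔ : Δ.Finite) (B : ℕ) : ContextFreeGrammar α :=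
  ⟨RunSymbol n r, .start, (finite_shortRules hΔ B).toFinset⟩

variable {K M : ℕ}

lemma mem_runGrammar_rules {hΔ : Δ.Finite} {B : ℕ} {A : RunSymbol n r}
    {γ : List (Symbol α (RunSymbol n r))} (h : RunRule Δ ⟨A, γ⟩) (hA : A.IsShort B)
    (hγ : ∀ s ∈ γ, IsShortSymbol Δ B s) : ⟨A, γ⟩ ∈ (runGrammar hΔ B).rules :=
  (Set.Finite.mem_toFinset _).2 ⟨h, hA, hγ⟩

lemma derives_run (hΔ : Δ.Finite) (hK : ∀ t ∈ Δ, t.2.1.2.length = K)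
    (hM : ∀ t ∈ Δ, t.2.2.2.length ≤ M) {w : List α}
    {a b : Fin r × List (Fin n)} (ha : a.2.length ≤ M + 2) (hb : b.2.length ≤ M + 2)
    (h : Run Δ w a b) :
    (runGrammar hΔ (M + 2)).Derives [.nonterminal (.run a b)] (w.map .terminal) := by
  induction hN : w.length using Nat.strong_induction_on generalizing w a b with
  | _ N ih =>
    cases w with
    | nil =>
      obtain rfl : a = b := h
      exact derives_of_rule (mem_runGrammar_rules (.run_nil a) ⟨ha, hb⟩ (by simp)) (.refl _)
    | cons l w =>
      obtain ⟨c, c', v, hl, rfl, h⟩ := h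
      have hc : c.2.length = K := hK _ hl
      have hc' : c'.2.length ≤ M := hM _ hl
      simp only [extend_snd, List.length_append] at ha
      obtain ⟨w₁, w₂, e, rfl, h1, h2, he⟩ := h.exists_pop (L := M + 2 - v.length)
        (fun t ht => by rw [hK t ht]; omega) (by omega)
      have hev : (extend e v).2.length ≤ M + 2 := by simp; omega
      subst hN
      have d1 := ih w₁.length (by simp) (by omega) (by omega) h1 rfl
      have d2 := ih w₂.length (by simp) hev hb h2 rfl
      refine derives_of_rule (mem_runGrammar_rules (.run_cons l c c' v e b hl)
        ⟨by simpa using ha, hb⟩ ?_) ?_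
      · simp only [List.mem_cons, List.not_mem_nil, or_false, forall_eq_or_imp, forall_eq]
        exact ⟨⟨c, c', hl⟩, ⟨by omega, by omega⟩, hev, hb⟩
      · rw [List.map_cons, List.map_append]
        exact (derives_append d1 d2).append_left [Symbol.terminal l]

lemma derives_free (hΔ : Δ.Finite) (hK : ∀ t ∈ Δ, t.2.1.2.length = K)
    (hM : ∀ t ∈ Δ, t.2.2.2.length ≤ M) (hKM : K ≤ M) {w₁ w₂ : List α} (v v' : List (Fin n))
    {a b d : Fin r × List (Fin n)} (ha : a.2.length ≤ M + 1) (hb : b.2.length ≤ M + 1)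
    (hd : d.2.length ≤ M + 1) (h1 : Run Δ w₁ (extend a v) d) (h2 : Run Δ w₂ d (extend b v')) :
    (runGrammar hΔ (M + 2)).Derives [.nonterminal (.free a b)] ((w₁ ++ w₂).map .terminal) := by
  induction v generalizing a w₁ with
  | cons x v ih =>
    rw [← List.singleton_append, extend_append] at h1
    obtain ⟨w₁, w₃, e, rfl, h1, h3, he⟩ := h1.exists_pop (L := M + 1)
      (fun t ht => by rw [hK t ht]; omega) (by omega)
    have hax : (extend a [x]).2.length ≤ M + 2 := by simpa using ha
    refine derives_of_rule (mem_runGrammar_rules (.free_left a b e x) ⟨by omega, by omega⟩ ?_) ?_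
    · simp only [List.mem_cons, List.not_mem_nil, or_false, forall_eq_or_imp, forall_eq]
      exact ⟨⟨hax, by omega⟩, by omega, by omega⟩
    · rw [List.append_assoc, List.map_append]
      exact derives_append (derives_run hΔ hK hM hax (by omega) h1) (ih he h3)
  | nil =>
    rw [extend_nil] at h1
    induction v' generalizing b w₂ with
    | cons x v ih =>
      rw [← List.singleton_append, extend_append] at h2
      obtain ⟨w₂, w₃, e, rfl, h2, h3, he⟩ := h2.exists_push (L := M + 1)
        (fun t ht => (hM t ht).trans (by omega)) (by omega)
      have hbx : (extend b [x]).2.length ≤ M + 2 := by simpa using hb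
      refine derives_of_rule (mem_runGrammar_rules (.free_right a b e x)
        ⟨by omega, by omega⟩ ?_) ?_
      · simp only [List.mem_cons, List.not_mem_nil, or_false, forall_eq_or_imp, forall_eq]
        exact ⟨⟨by omega, by omega⟩, by omega, hbx⟩
      · rw [← List.append_assoc, List.map_append]
        exact derives_append (ih he h2) (derives_run hΔ hK hM (by omega) hbx h3)
    | nil =>
      rw [extend_nil] at h2
      have hab : RunSymbol.IsShort (M + 2) (.run a b) := ⟨by omega, by omega⟩
      exact derives_of_rule
        (mem_runGrammar_rules (.free_run a b) hab (List.forall_mem_singleton.2 hab))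
        (derives_run hΔ hK hM hab.1 hab.2 (run_append.2 ⟨d, h1, h2⟩))

lemma derives_differ (hΔ : Δ.Finite) (hK : ∀ t ∈ Δ, t.2.1.2.length = K)
    (hM : ∀ t ∈ Δ, t.2.2.2.length ≤ M) (hKM : K ≤ M) {w₁ w₂ : List α} {v v' : List (Fin n)}
    (hv : Differ v v') {a b d : Fin r × List (Fin n)} (ha : a.2.length ≤ M + 1)
    (hb : b.2.length ≤ M + 1) (hd : d.2.length ≤ M + 1) (h1 : Run Δ w₁ (extend a v) d)
    (h2 : Run Δ w₂ d (extend b v')) :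
    (runGrammar hΔ (M + 2)).Derives [.nonterminal (.differ a b)]
      ((w₁ ++ w₂).map .terminal) := by
  have peel : ∀ (a b : Fin r × List (Fin n)), a.2.length ≤ M + 1 → b.2.length ≤ M + 1 →
      ∀ x y v v' w₁ w₂, Run Δ w₁ (extend a (x :: v)) d →
      Run Δ w₂ d (extend b (y :: v')) →
      ∃ e e' u₁ u₂ u₃ u₄, w₁ = u₁ ++ u₂ ∧ w₂ = u₃ ++ u₄ ∧ e.2.length ≤ M + 1 ∧
        e'.2.length ≤ M + 1 ∧ Run Δ u₂ (extend e v) d ∧ Run Δ u₃ d (extend e' v') ∧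
        (extend a [x]).2.length ≤ M + 2 ∧ (extend b [y]).2.length ≤ M + 2 ∧
        (runGrammar hΔ (M + 2)).Derives [.nonterminal (.run (extend a [x]) e)]
          (u₁.map .terminal) ∧
        (runGrammar hΔ (M + 2)).Derives [.nonterminal (.run e' (extend b [y]))]
          (u₄.map .terminal) := by
    intro a b ha hb x y v v' w₁ w₂ h1 h2
    rw [← List.singleton_append, extend_append] at h1 h2
    obtain ⟨u₁, u₂, e, rfl, h1, h3, he⟩ := h1.exists_pop (L := M + 1)
      (fun t ht => by rw [hK t ht]; omega) (by omega)
    obtain ⟨u₃, u₄, e', rfl, h2, h4, he'⟩ := h2.exists_push (L := M + 1)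
      (fun t ht => (hM t ht).trans (by omega)) (by omega)
    have hax : (extend a [x]).2.length ≤ M + 2 := by simpa using ha
    have hbx : (extend b [y]).2.length ≤ M + 2 := by simpa using hb
    exact ⟨e, e', u₁, u₂, u₃, u₄, rfl, rfl, he, he', h3, h2, hax, hbx,
      derives_run hΔ hK hM hax (by omega) h1, derives_run hΔ hK hM (by omega) hbx h4⟩
  have assoc : ∀ u₁ u₂ u₃ u₄ : List α, u₁ ++ u₂ ++ (u₃ ++ u₄) = u₁ ++ (u₂ ++ u₃) ++ u₄ := by simp
  induction hv generalizing a b w₁ w₂ with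
  | @head x y h v v' =>
    obtain ⟨e, e', u₁, u₂, u₃, u₄, rfl, rfl, he, he', h3, h4, hax, hby, d1, d2⟩ :=
      peel a b ha hb x y v v' w₁ w₂ h1 h2
    refine derives_of_rule (mem_runGrammar_rules (.differ_ne a b e e' x y h)
      ⟨by omega, by omega⟩ ?_) ?_
    · simp only [List.mem_cons, List.not_mem_nil, or_false, forall_eq_or_imp, forall_eq]
      exact ⟨⟨hax, by omega⟩, ⟨by omega, by omega⟩, by omega, hby⟩
    · rw [assoc, List.map_append, List.map_append]
      exact derives_append (derives_append d1 (derives_free hΔ hK hM hKM v v' he he' hd h3 h4)) d2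
  | @cons x v v' h ih =>
    obtain ⟨e, e', u₁, u₂, u₃, u₄, rfl, rfl, he, he', h3, h4, hax, hby, d1, d2⟩ :=
      peel a b ha hb x x v v' w₁ w₂ h1 h2
    refine derives_of_rule (mem_runGrammar_rules (.differ_same a b e e' x)
      ⟨by omega, by omega⟩ ?_) ?_
    · simp only [List.mem_cons, List.not_mem_nil, or_false, forall_eq_or_imp, forall_eq]
      exact ⟨⟨hax, by omega⟩, ⟨by omega, by omega⟩, by omega, hby⟩
    · rw [assoc, List.map_append, List.map_append]
      exact derives_append (derives_append d1 (ih he he' h3 h4)) d2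

theorem isContextFree_runs [Nontrivial (Fin n)] (hΔ : Δ.Finite)
    (hK : ∀ t ∈ Δ, t.2.1.2.length = K) (hM : ∀ t ∈ Δ, t.2.2.2.length ≤ M) (hKM : K ≤ M) :
    Language.IsContextFree {w : List α | ∃ u u', u ≠ u' ∧ Run Δ w u u'} := by
  refine ⟨runGrammar hΔ (M + 2), Set.ext fun w => ⟨fun hw => ?_, ?_⟩⟩
  · have := interpret_le_of_derives _ (runLanguage Δ) (fun ρ hρ w hw =>
      RunRule.sound ((Set.Finite.mem_toFinset _).1 hρ).1 hw) hw
    exact mem_interpret_nonterminal.1 (this (interpret_terminals _ w))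
  · rintro ⟨u, u', hne, h⟩
    obtain ⟨w₁, w₂, p, d, p', rfl, h1, h2, hd, hp⟩ :=
      h.exists_short (L := M) (fun t ht => by rw [hK t ht]; omega) hne
    obtain ⟨x, hx⟩ := exists_apart_extend hp
    replace h1 := h1.extend_both [x]
    replace h2 := h2.extend_both [x]
    have hd : (extend d [x]).2.length ≤ M + 1 := by simpa using hd
    have key : ∀ p : Fin r × List (Fin n), extend (p.1, []) (p.2 ++ [x]) = extend p [x] :=
      fun p => by simp [extend]
    rw [← key p] at h1
    rw [← key p'] at h2
    change (runGrammar hΔ (M + 2)).Derives [.nonterminal .start] _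
    by_cases hq : p.1 = p'.1
    · rw [← hq] at h2
      refine derives_of_rule (mem_runGrammar_rules (.start_same p.1) trivial ?_)
        (derives_differ hΔ hK hM hKM (hx.resolve_left fun h => h hq) (by simp) (by simp) hd h1 h2)
      simp [IsShortSymbol, RunSymbol.IsShort]
    · refine derives_of_rule (mem_runGrammar_rules (.start_ne p.1 p'.1 hq) trivial ?_)
        (derives_free hΔ hK hM hKM _ _ (by simp) (by simp) hd h1 h2)
      simp [IsShortSymbol, RunSymbol.IsShort]

end RunGrammar

section CowordProblem

variable {n r : ℕ}

lemma exists_conePoint_ne [Nontrivial (Fin n)] {p p' : Fin r × List (Fin n)} (h : p ≠ p') :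
    ∃ ω, conePoint p ω ≠ conePoint p' ω := by
  obtain ⟨x, hx⟩ := exists_apart_extend h
  refine ⟨prepend [x] fun _ => x, ?_⟩
  rw [← conePoint_extend, ← conePoint_extend]
  exact hx.conePoint_ne _ _

lemma evalWord_cons {G A : Type*} [Group G] (f : A → G) (l : A × Bool) (w : List (A × Bool)) :
    evalWord f (l :: w) = evalWord f [l] * evalWord f w := by
  simp [evalWord]

lemma Run.evalWord_inv_apply {A : Type*} {f : A → Equiv.Perm (Fin r × (ℕ → Fin n))}
    {Δ : Set ((A × Bool) × (Fin r × List (Fin n)) × (Fin r × List (Fin n)))}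
    (hΔ : ∀ t ∈ Δ, ∀ ω, (evalWord f [t.1])⁻¹ (conePoint t.2.1 ω) = conePoint t.2.2 ω)
    {w : List (A × Bool)} {u u' : Fin r × List (Fin n)} (h : Run Δ w u u') (ω : ℕ → Fin n) :
    (evalWord f w)⁻¹ (conePoint u ω) = conePoint u' ω := by
  induction w generalizing u with
  | nil =>
    obtain rfl : u = u' := h
    simp [evalWord]
  | cons l w ih =>
    obtain ⟨c, c', v, hl, rfl, h⟩ := h
    rw [evalWord_cons, mul_inv_rev, Equiv.Perm.mul_apply, conePoint_extend, hΔ _ hl,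
      ← conePoint_extend]
    exact ih h

theorem isContextFree_evalWord_ne_one [Nontrivial (Fin n)] {A : Type*} [Finite A]
    (f : A → Equiv.Perm (Fin r × (ℕ → Fin n)))
    (hf : ∀ a, IsPrefixReplacement (f a)) (hf' : ∀ a, IsPrefixReplacement (f a)⁻¹) :
    Language.IsContextFree {w : List (A × Bool) | evalWord f w ≠ 1} := by
  have hdepth : ∀ l : A × Bool, ∃ k, HasDepth (evalWord f [l])⁻¹ k := by
    rintro ⟨a, _ | _⟩
    · simpa [evalWord] using isPrefixReplacement_iff.1 (hf a)
    · simpa [evalWord] using isPrefixReplacement_iff.1 (hf' a)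
  choose k hk using hdepth
  obtain ⟨K, hK⟩ := (Set.finite_range k).bddAbove
  choose! F hF using fun l => (hk l).mono (hK (Set.mem_range_self l))
  let Δ : Set ((A × Bool) × (Fin r × List (Fin n)) × (Fin r × List (Fin n))) :=
    (fun t : (A × Bool) × (Fin r × List (Fin n)) => (t.1, t.2, F t.1 t.2)) ''
      (Set.univ ×ˢ {p | p.2.length = K})
  have hΔ : Δ.Finite := (Set.finite_univ.prod
    ((finite_setOf_length_le K).subset fun _ hp => le_of_eq hp)).image _
  obtain ⟨M, hM⟩ := (hΔ.image fun t => t.2.2.2.length).bddAbove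
  have hΔ' : ∀ t ∈ Δ, ∀ ω, (evalWord f [t.1])⁻¹ (conePoint t.2.1 ω) = conePoint t.2.2 ω := by
    rintro _ ⟨⟨l, c⟩, ⟨-, hc⟩, rfl⟩
    exact hF l c hc
  have hcf := isContextFree_runs (K := K) (M := max K M) hΔ
    (by rintro _ ⟨⟨l, c⟩, ⟨-, hc⟩, rfl⟩; exact hc)
    (fun t ht => (hM (Set.mem_image_of_mem _ ht)).trans (le_max_right _ _)) (le_max_left _ _)
  refine (congrArg Language.IsContextFree (Set.ext fun w => ⟨fun hw => ?_, ?_⟩)).mpr hcf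
  · obtain ⟨x, hx⟩ : ∃ x, (evalWord f w)⁻¹ x ≠ x := by
      by_contra! h
      exact hw (inv_eq_one.1 (Equiv.ext h))
    obtain ⟨u, ω, hu, rfl⟩ := exists_eq_conePoint x (K * w.length)
    obtain ⟨u', h⟩ := exists_run (Δ := Δ) (fun l c hc => ⟨F l c, (l, c), ⟨trivial, hc⟩, rfl⟩)
      w u hu.ge
    refine ⟨u, u', ?_, h⟩
    rintro rfl
    exact hx (h.evalWord_inv_apply hΔ' ω)
  · rintro ⟨u, u', hne, h⟩ hw
    obtain ⟨ω, hω⟩ := exists_conePoint_ne hne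
    refine hω ?_
    rw [← h.evalWord_inv_apply hΔ' ω, hw]
    simp

end CowordProblem

section Bases

variable {n r : ℕ} {I J : Type}

/-- A family of addresses is a basis if its cones partition the whole space. -/
def IsBasis (b : I → Fin r × List (Fin n)) : Prop :=
  Function.Bijective fun x : I × (ℕ → Fin n) => conePoint (b x.1) x.2

/-- `Carries b c σ` says that `σ` maps the cones of `b` canonically to the cones of `c`. -/
def Carries (b c : I → Fin r × List (Fin n)) (σ : Equiv.Perm (Fin r × (ℕ → Fin n))) : Prop :=
  ∀ i ω, σ (conePoint (b i) ω) = conePoint (c i) ω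

/-- A permutation has size `m` if it carries a basis with `m` elements to another one. -/
def HasSize (m : ℕ) (σ : Equiv.Perm (Fin r × (ℕ → Fin n))) : Prop :=
  ∃ b b' : Fin m → Fin r × List (Fin n), IsBasis b ∧ IsBasis b' ∧ Carries b b' σ

lemma conePoint_injective (p : Fin r × List (Fin n)) : Function.Injective (conePoint p) := by
  intro ω ω' h
  obtain ⟨u, hu, rfl⟩ := exists_extend_of_conePoint_eq h le_rfl
  have : u = [] := by simpa [extend, Prod.ext_iff] using hu
  simp [this]

lemma exists_conePoint_eq_extend (p : Fin r × List (Fin n)) (ω : ℕ → Fin n) :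
    ∃ x ω', conePoint p ω = conePoint (extend p [x]) ω' := by
  obtain ⟨w, ω', hw, rfl⟩ := exists_eq_prepend ω 1
  obtain ⟨x, rfl⟩ := List.length_eq_one_iff.1 hw
  exact ⟨x, ω', (conePoint_extend _ _ _).symm⟩

lemma isBasis_of_exists {b : I → Fin r × List (Fin n)}
    (h : ∀ i j ω ω', conePoint (b i) ω = conePoint (b j) ω' → i = j)
    (h' : ∀ x, ∃ i ω, x = conePoint (b i) ω) : IsBasis b := by
  constructor
  · rintro ⟨i, ω⟩ ⟨j, ω'⟩ e
    obtain rfl := h _ _ _ _ e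
    exact congrArg (Prod.mk i) (conePoint_injective _ e)
  · intro x
    obtain ⟨i, ω, rfl⟩ := h' x
    exact ⟨(i, ω), rfl⟩

namespace IsBasis

variable {b b' : I → Fin r × List (Fin n)}

lemma eq_of_conePoint_eq (hb : IsBasis b) {i j : I} {ω ω' : ℕ → Fin n}
    (h : conePoint (b i) ω = conePoint (b j) ω') : i = j :=
  congrArg Prod.fst (@hb.1 (i, ω) (j, ω') h)

lemma exists_eq (hb : IsBasis b) (x : Fin r × (ℕ → Fin n)) : ∃ i ω, x = conePoint (b i) ω := by
  obtain ⟨y, rfl⟩ := hb.2 x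
  exact ⟨y.1, y.2, rfl⟩

lemma eq_of_eq_extend [Nonempty (Fin n)] (hb : IsBasis b) {i j : I} {u : List (Fin n)}
    (h : b i = extend (b j) u) : i = j := by
  let ω : ℕ → Fin n := fun _ => Classical.arbitrary _
  exact hb.eq_of_conePoint_eq (ω := ω) (ω' := prepend u ω) (by rw [h, conePoint_extend])

lemma injective [Nonempty (Fin n)] (hb : IsBasis b) : Function.Injective b := fun _ _ h =>
  hb.eq_of_eq_extend (u := []) (by simpa using h)

lemma reindex (hb : IsBasis b) (e : J ≃ I) : IsBasis (b ∘ e) := by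
  refine isBasis_of_exists (fun i j ω ω' h => e.injective (hb.eq_of_conePoint_eq h)) fun x => ?_
  obtain ⟨i, ω, rfl⟩ := hb.exists_eq x
  exact ⟨e.symm i, ω, by simp⟩

lemma exists_carries (hb : IsBasis b) (hb' : IsBasis b') : ∃ σ, Carries b b' σ := by
  refine ⟨(Equiv.ofBijective _ hb).symm.trans (Equiv.ofBijective _ hb'), fun i ω => ?_⟩
  exact congrArg (Equiv.ofBijective _ hb') ((Equiv.ofBijective _ hb).symm_apply_apply (i, ω))

lemma carries_unique (hb : IsBasis b) {σ τ : Equiv.Perm (Fin r × (ℕ → Fin n))}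
    (hσ : Carries b b' σ) (hτ : Carries b b' τ) : σ = τ := by
  ext1 x
  obtain ⟨i, ω, rfl⟩ := hb.exists_eq x
  rw [hσ, hτ]

end IsBasis

namespace Carries

variable {b b' b'' : I → Fin r × List (Fin n)} {σ τ : Equiv.Perm (Fin r × (ℕ → Fin n))}

lemma mul (hτ : Carries b' b'' τ) (hσ : Carries b b' σ) : Carries b b'' (τ * σ) := fun i ω => by
  rw [Equiv.Perm.mul_apply, hσ, hτ]

lemma inv (hσ : Carries b b' σ) : Carries b' b σ⁻¹ := fun i ω => by
  rw [← hσ]; simp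

lemma reindex (hσ : Carries b b' σ) (e : J → I) : Carries (b ∘ e) (b' ∘ e) σ := fun i => hσ (e i)

lemma isBasis (hσ : Carries b b' σ) (hb : IsBasis b) : IsBasis b' := by
  refine isBasis_of_exists (fun i j ω ω' h => ?_) fun x => ?_
  · rw [← hσ, ← hσ] at h
    exact hb.eq_of_conePoint_eq (σ.injective h)
  · obtain ⟨i, ω, h⟩ := hb.exists_eq (σ⁻¹ x)
    exact ⟨i, ω, by rw [← hσ, ← h]; simp⟩

lemma hasSize [Finite I] (hσ : Carries b b' σ) (hb : IsBasis b) : HasSize (Nat.card I) σ :=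
  ⟨_, _, hb.reindex (Finite.equivFin I).symm, (hσ.isBasis hb).reindex _, hσ.reindex _⟩

end Carries

/-- Replace the elements `extend p [x]` of a basis, indexed by `κ x`, by the single element `p`. -/
def contract (b : I → Fin r × List (Fin n)) (κ : Fin n → I) (p : Fin r × List (Fin n)) :
    Option {i // i ∉ Set.range κ} → Fin r × List (Fin n)
  | none => p
  | some j => b j

section Contract

variable {b b' : I → Fin r × List (Fin n)} {κ : Fin n → I} {p p' : Fin r × List (Fin n)}

lemma IsBasis.contract (hb : IsBasis b) (h : ∀ x, b (κ x) = extend p [x]) :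
    IsBasis (contract b κ p) := by
  have key : ∀ (j : {i // i ∉ Set.range κ}) ω ω', conePoint p ω ≠ conePoint (b j) ω' := by
    intro j ω ω' e
    obtain ⟨x, ω'', h'⟩ := exists_conePoint_eq_extend p ω
    rw [h', ← h] at e
    exact j.2 ⟨x, hb.eq_of_conePoint_eq e⟩
  refine isBasis_of_exists ?_ fun x => ?_
  · rintro (_ | i) (_ | j) ω ω' e
    · rfl
    · exact absurd e (key _ _ _)
    · exact absurd e.symm (key _ _ _)
    · exact congrArg some (Subtype.ext (hb.eq_of_conePoint_eq e))
  · obtain ⟨i, ω, rfl⟩ := hb.exists_eq x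
    by_cases hi : i ∈ Set.range κ
    · obtain ⟨x, rfl⟩ := hi
      exact ⟨none, prepend [x] ω, by rw [h, conePoint_extend]; rfl⟩
    · exact ⟨some ⟨i, hi⟩, ω, rfl⟩

lemma Carries.contract {σ : Equiv.Perm (Fin r × (ℕ → Fin n))} (hσ : Carries b b' σ)
    (h : ∀ x, b (κ x) = extend p [x]) (h' : ∀ x, b' (κ x) = extend p' [x]) :
    Carries (contract b κ p) (contract b' κ p') σ := by
  rintro (_ | i) ω
  · obtain ⟨w, ω', hw, rfl⟩ := exists_eq_prepend ω 1
    obtain ⟨x, rfl⟩ := List.length_eq_one_iff.1 hw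
    change σ (conePoint p _) = conePoint p' _
    rw [← conePoint_extend, ← conePoint_extend, ← h, ← h', hσ]
  · exact hσ i ω

lemma injective_of_eq_extend (h : ∀ x, b (κ x) = extend p [x]) : Function.Injective κ := by
  intro x y e
  have := (h x).symm.trans ((congrArg b e).trans (h y))
  simpa [extend] using this

lemma card_contract [Finite I] (hκ : Function.Injective κ) :
    Nat.card (Option {i // i ∉ Set.range κ}) + n = Nat.card I + 1 := by
  classical
  have := Fintype.ofFinite I
  have h1 := Fintype.card_subtype_compl (· ∈ Set.range κ)
  have h2 : Fintype.card {i // i ∈ Set.range κ} = n := by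
    rw [← Nat.card_eq_fintype_card]
    exact (Nat.card_range_of_injective hκ).trans (Nat.card_fin n)
  have h3 := Fintype.card_subtype_le (· ∈ Set.range κ)
  rw [Nat.card_eq_fintype_card, Nat.card_eq_fintype_card, Fintype.card_option]
  omega

lemma Carries.hasSize_contract [Finite I] {σ : Equiv.Perm (Fin r × (ℕ → Fin n))}
    (hσ : Carries b b' σ) (hb : IsBasis b) (h : ∀ x, b (κ x) = extend p [x])
    (h' : ∀ x, b' (κ x) = extend p' [x]) : HasSize (Nat.card I + 1 - n) σ := by
  rw [← card_contract (injective_of_eq_extend h), Nat.add_sub_cancel]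
  exact (hσ.contract h h').hasSize (hb.contract h)

/-- A basis not consisting of roots contains all the children of some address of maximal length
among the proper prefixes of its elements. -/
lemma IsBasis.exists_children [Finite I] [Nonempty (Fin n)] (hb : IsBasis b) {i₀ : I}
    (h₀ : (b i₀).2 ≠ []) :
    ∃ (κ : Fin n → I) (p : Fin r × List (Fin n)), (∀ x, b (κ x) = extend p [x]) ∧
      ∀ i, (b i).2.length ≤ p.2.length + 1 := by
  have : Nonempty I := ⟨i₀⟩
  obtain ⟨i, hi⟩ := Finite.exists_max fun i => (b i).2.length
  have hpos : (b i).2 ≠ [] := by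
    have := List.length_pos_iff.2 h₀
    exact List.length_pos_iff.1 (this.trans_le (hi i₀))
  obtain ⟨w, y, hw⟩ := (List.eq_nil_or_concat (b i).2).resolve_left hpos
  rw [List.concat_eq_append] at hw
  obtain ⟨p, hp⟩ : ∃ p, b i = extend p [y] := ⟨((b i).1, w), Prod.ext rfl hw⟩
  have hlen : (b i).2.length = p.2.length + 1 := by simp [hp]
  suffices h : ∀ x, ∃ j, b j = extend p [x] by
    choose κ hκ using h
    exact ⟨κ, p, hκ, fun j => hlen ▸ hi j⟩
  intro x
  obtain ⟨j, ω, hj⟩ := hb.exists_eq (conePoint (extend p [x]) fun _ => x)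
  obtain ⟨u, hu, -⟩ := exists_extend_of_conePoint_eq hj.symm (by simpa [hlen] using hi j)
  rcases List.eq_nil_or_concat u with rfl | ⟨u, z, rfl⟩
  · exact ⟨j, by simpa using hu.symm⟩
  · rw [List.concat_eq_append, extend_append] at hu
    have hp' : p = extend (b j) u := by
      have h1 := congrArg Prod.fst hu
      have h2 := congrArg Prod.snd hu
      simp only [extend_fst, extend_snd] at h1 h2
      exact Prod.ext h1 (List.append_inj_left' h2 rfl)
    have hij : i = j := hb.eq_of_eq_extend (u := u ++ [y]) (by rw [extend_append, ← hp', hp])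
    have := congrArg (fun p => p.2.length) hp'
    simp only [extend_snd, List.length_append, ← hij, hlen] at this
    omega

lemma IsBasis.exists_ne_nil [Finite I] [Nonempty (Fin n)] (hb : IsBasis b)
    (h : r < Nat.card I) : ∃ i, (b i).2 ≠ [] := by
  by_contra! h'
  have : Function.Injective fun i => (b i).1 := fun i j e =>
    hb.injective (Prod.ext e (by rw [h', h']))
  have := Nat.card_le_card_of_injective _ this
  simp at this
  omega

lemma IsBasis.exists_smaller [Finite I] (hn : 2 ≤ n) (hb : IsBasis b) (h : r < Nat.card I) :
    ∃ (k : ℕ) (c : Fin k → Fin r × List (Fin n)), k + n = Nat.card I + 1 ∧ IsBasis c := by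
  have : Nonempty (Fin n) := ⟨⟨0, by omega⟩⟩
  obtain ⟨i, hi⟩ := hb.exists_ne_nil h
  obtain ⟨κ, p, hκ, -⟩ := hb.exists_children hi
  exact ⟨_, _, card_contract (injective_of_eq_extend hκ),
    (hb.contract hκ).reindex (Finite.equivFin _).symm⟩

end Contract

lemma IsBasis.length_le [Finite I] (hn : 2 ≤ n) {b : I → Fin r × List (Fin n)} (hb : IsBasis b)
    (i : I) : (b i).2.length ≤ Nat.card I := by
  induction hm : Nat.card I using Nat.strong_induction_on generalizing I with
  | _ m ih =>
    subst hm
    have : Nonempty (Fin n) := ⟨⟨0, by omega⟩⟩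
    by_cases hi : (b i).2 = []
    · simp [hi]
    · obtain ⟨κ, p, hκ, hp⟩ := hb.exists_children hi
      have hcard := card_contract (injective_of_eq_extend hκ)
      have h1 := ih _ (by omega) (hb.contract hκ) none rfl
      have h2 := hp i
      change p.2.length ≤ _ at h1
      omega

lemma finite_setOf_hasSize (hn : 2 ≤ n) (m : ℕ) :
    {σ : Equiv.Perm (Fin r × (ℕ → Fin n)) | HasSize m σ}.Finite := by
  have hfin : {b : Fin m → Fin r × List (Fin n) | ∀ i, b i ∈ {p | p.2.length ≤ m}}.Finite :=
    Set.Finite.pi' fun _ => finite_setOf_length_le m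
  refine ((hfin.prod hfin).biUnion (t := fun c => {σ | IsBasis c.1 ∧ Carries c.1 c.2 σ})
    fun c _ => Set.Subsingleton.finite fun σ hσ τ hτ => hσ.1.carries_unique hσ.2 hτ.2).subset ?_
  rintro σ ⟨b, b', hb, hb', hσ⟩
  refine Set.mem_iUnion₂.2 ⟨(b, b'), ⟨fun i => ?_, fun i => ?_⟩, hb, hσ⟩
  · simpa using hb.length_le hn i
  · simpa using hb'.length_le hn i

/-- Replace the elements of a basis with index in `P` by all their children. -/
def expand {M P : Type} (ε : M ⊕ P → Fin r × List (Fin n)) :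
    M ⊕ (P × Fin n) → Fin r × List (Fin n)
  | .inl i => ε (.inl i)
  | .inr y => extend (ε (.inr y.1)) [y.2]

lemma IsBasis.expand {M P : Type} {ε : M ⊕ P → Fin r × List (Fin n)} (hε : IsBasis ε) :
    IsBasis (expand ε) := by
  refine isBasis_of_exists ?_ fun x => ?_
  · rintro (i | ⟨i, x⟩) (j | ⟨j, y⟩) ω ω' e <;>
      simp only [_root_.expand, conePoint_extend] at e <;>
      have hij := hε.eq_of_conePoint_eq e
    · simpa using hij
    · simp at hij
    · simp at hij
    · obtain rfl : i = j := by simpa using hij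
      rw [(prepend_cons_inj.1 (conePoint_injective _ e)).1]
  · obtain ⟨i | i, ω, rfl⟩ := hε.exists_eq x
    · exact ⟨.inl i, ω, rfl⟩
    · obtain ⟨x, ω', h⟩ := exists_conePoint_eq_extend (ε (.inr i)) ω
      exact ⟨.inr (i, x), ω', h⟩

lemma exists_perm_extending {α β : Type*} [Finite α] {κ κ' : β → α} (hκ : Function.Injective κ)
    (hκ' : Function.Injective κ') : ∃ ρ : Equiv.Perm α, ∀ x, ρ (κ x) = κ' x := by
  classical
  have := Fintype.ofFinite α
  let e : {a // a ∈ Set.range κ} ≃ {a // a ∈ Set.range κ'} :=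
    (Equiv.ofInjective κ hκ).symm.trans (Equiv.ofInjective κ' hκ')
  refine ⟨e.extendSubtype, fun x => ?_⟩
  rw [Equiv.extendSubtype_apply_of_mem e _ ⟨x, rfl⟩]
  change ((Equiv.ofInjective κ' hκ') ((Equiv.ofInjective κ hκ).symm (Equiv.ofInjective κ hκ x)) : α)
    = _
  simp

section Generation

variable {l : ℕ} {ε : Fin l ⊕ Fin 3 → Fin r × List (Fin n)}
  {b b' : Fin l ⊕ (Fin 3 × Fin n) → Fin r × List (Fin n)}
  {H : Subgroup (Equiv.Perm (Fin r × (ℕ → Fin n)))}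

lemma exists_perm_mem_of_carries_expand (hn : 2 ≤ n) (hr : r < l + 3 * n)
    (hH : ∀ σ, HasSize (l + 3 * n + 1 - n) σ → σ ∈ H) (hb : IsBasis b) :
    ∃ ρ : Equiv.Perm (Fin l ⊕ (Fin 3 × Fin n)), ∀ σ, Carries b (expand ε ∘ ρ) σ → σ ∈ H := by
  have : Nonempty (Fin n) := ⟨⟨0, by omega⟩⟩
  obtain ⟨i, hi⟩ := hb.exists_ne_nil (by simpa using hr)
  obtain ⟨κ, p, hκ, -⟩ := hb.exists_children hi
  obtain ⟨ρ, hρ⟩ := exists_perm_extending (injective_of_eq_extend hκ)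
    (κ' := fun x => (Sum.inr (0, x) : Fin l ⊕ (Fin 3 × Fin n))) fun x y h => by simpa using h
  refine ⟨ρ, fun σ hσ => hH σ ?_⟩
  simpa using hσ.hasSize_contract hb hκ (p' := ε (.inr 0)) fun x => by simp [hρ, expand]

lemma mem_of_carries_expand_perm (hε : IsBasis ε)
    (hH : ∀ σ, HasSize (l + 3 * n + 1 - n) σ → σ ∈ H)
    (π : Equiv.Perm (Fin l ⊕ (Fin 3 × Fin n))) {σ : Equiv.Perm (Fin r × (ℕ → Fin n))}
    (hσ : Carries (expand ε) (expand ε ∘ π) σ) : σ ∈ H := by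
  induction π using Equiv.Perm.swap_induction_on generalizing σ with
  | one =>
    rw [hε.expand.carries_unique hσ (τ := 1) fun _ _ => rfl]
    exact H.one_mem
  | swap_mul f x y _ ih =>
    obtain ⟨τ, hτ⟩ := hε.expand.exists_carries (hε.expand.reindex f)
    obtain ⟨τ', hτ'⟩ := hε.expand.exists_carries (hε.expand.reindex (Equiv.swap x y))
    rw [hε.expand.carries_unique hσ ((hτ'.reindex f).mul hτ)]
    refine H.mul_mem (hH _ ?_) (ih hτ)
    let block : Fin l ⊕ (Fin 3 × Fin n) → Option (Fin 3) := Sum.elim (fun _ => none) (some ·.1)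
    obtain ⟨c, hx, hy⟩ : ∃ c, some c ≠ block x ∧ some c ≠ block y := by
      generalize block x = s, block y = t
      decide +revert
    have h : ∀ z, Equiv.swap x y (.inr (c, z)) = .inr (c, z) := fun z =>
      Equiv.swap_apply_of_ne_of_ne (by rintro rfl; exact hx rfl) (by rintro rfl; exact hy rfl)
    simpa using hτ'.hasSize_contract hε.expand (κ := fun z => .inr (c, z)) (p := ε (.inr c))
      (p' := ε (.inr c)) (fun _ => rfl) fun z => by simp [h, expand]

lemma mem_of_carries (hn : 2 ≤ n) (hr : r < l + 3 * n) (hε : IsBasis ε)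
    (hH : ∀ σ, HasSize (l + 3 * n + 1 - n) σ → σ ∈ H) (hb : IsBasis b)
    {σ : Equiv.Perm (Fin r × (ℕ → Fin n))} (hσ : Carries b b' σ) : σ ∈ H := by
  have hb' := hσ.isBasis hb
  obtain ⟨ρ, hρ⟩ := exists_perm_mem_of_carries_expand (ε := ε) hn hr hH hb
  obtain ⟨ρ', hρ'⟩ := exists_perm_mem_of_carries_expand (ε := ε) hn hr hH hb'
  obtain ⟨τ, hτ⟩ := hb.exists_carries (hε.expand.reindex ρ)
  obtain ⟨τ', hτ'⟩ := hb'.exists_carries (hε.expand.reindex ρ')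
  have h : τ' * σ * τ⁻¹ ∈ H := by
    refine mem_of_carries_expand_perm hε hH (ρ.symm.trans ρ') ?_
    have := ((hτ'.mul hσ).mul hτ.inv).reindex ρ.symm
    simpa [Function.comp_assoc] using this
  have := H.mul_mem (H.mul_mem (H.inv_mem (hρ' _ hτ')) h) (hρ _ hτ)
  simpa [mul_assoc] using this

end Generation

lemma HasSize.mem (hn : 2 ≤ n) {H : Subgroup (Equiv.Perm (Fin r × (ℕ → Fin n)))}
    (hH : ∀ m < r + 3 * n, ∀ σ, HasSize m σ → σ ∈ H) {m : ℕ}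
    {σ : Equiv.Perm (Fin r × (ℕ → Fin n))} (hσ : HasSize m σ) : σ ∈ H := by
  induction m using Nat.strong_induction_on generalizing σ with
  | _ m ih =>
    by_cases hm : m < r + 3 * n
    · exact hH m hm σ hσ
    obtain ⟨b, b', hb, -, hσ⟩ := hσ
    obtain ⟨k₁, c₁, hk₁, hc₁⟩ := hb.exists_smaller hn (by simp; omega)
    obtain ⟨k₂, c₂, hk₂, hc₂⟩ := hc₁.exists_smaller hn (by simp at hk₁ ⊢; omega)
    obtain ⟨k₃, c₃, hk₃, hc₃⟩ := hc₂.exists_smaller hn (by simp at hk₁ hk₂ ⊢; omega)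
    simp only [Nat.card_eq_fintype_card, Fintype.card_fin] at hk₁ hk₂ hk₃
    obtain ⟨l, rfl⟩ : ∃ l, k₃ = l + 3 := ⟨k₃ - 3, by omega⟩
    obtain rfl : m = l + 3 * n := by omega
    let e : Fin l ⊕ (Fin 3 × Fin n) ≃ Fin (l + 3 * n) :=
      (Equiv.sumCongr (Equiv.refl _) finProdFinEquiv).trans finSumFinEquiv
    exact mem_of_carries hn (by omega) (hc₃.reindex finSumFinEquiv)
      (fun σ hσ => ih _ (by omega) hσ) (hb.reindex e) (hσ.reindex e)

lemma isPrefixReplacement_iff_hasSize (hn : 2 ≤ n) {σ : Equiv.Perm (Fin r × (ℕ → Fin n))} :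
    IsPrefixReplacement σ ↔ ∃ m, HasSize m σ := by
  rw [isPrefixReplacement_iff]
  constructor
  · rintro ⟨k, hk⟩
    let b : Fin r × List.Vector (Fin n) k → Fin r × List (Fin n) := fun i => (i.1, i.2.toList)
    have hb : IsBasis b := by
      refine isBasis_of_exists (fun i j ω ω' h => ?_) fun x => ?_
      · obtain ⟨u, hu, -⟩ := exists_extend_of_conePoint_eq h (by simp [b])
        have h1 := congrArg (fun p => p.2.length) hu
        have : u = [] := by simpa [b] using h1
        subst this
        simp only [extend_nil, b, Prod.mk.injEq] at hu
        exact (Prod.ext hu.1 (Subtype.ext hu.2)).symm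
      · obtain ⟨p, ω, hp, rfl⟩ := exists_eq_conePoint x k
        exact ⟨(p.1, ⟨p.2, hp⟩), ω, rfl⟩
    choose b' hb' using fun i => hk (b i) (by simp [b])
    exact ⟨_, Carries.hasSize (b' := b') (fun i => hb' i) hb⟩
  · rintro ⟨m, b, b', hb, -, hσ⟩
    refine ⟨m, fun p hp => ?_⟩
    have : Nonempty (Fin n) := ⟨⟨0, by omega⟩⟩
    obtain ⟨i, ω, h⟩ := hb.exists_eq (conePoint p fun _ => Classical.arbitrary _)
    have hi := hb.length_le hn i
    obtain ⟨u, rfl, -⟩ := exists_extend_of_conePoint_eq h.symm (by simp at hi; omega)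
    exact ⟨extend (b' i) u, fun ω => by rw [conePoint_extend, hσ, conePoint_extend]⟩

lemma IsPrefixReplacement.inv (hn : 2 ≤ n) {σ : Equiv.Perm (Fin r × (ℕ → Fin n))}
    (hσ : IsPrefixReplacement σ) : IsPrefixReplacement σ⁻¹ := by
  rw [isPrefixReplacement_iff_hasSize hn] at hσ ⊢
  obtain ⟨m, b, b', hb, hb', hσ⟩ := hσ
  exact ⟨m, b', b, hb', hb, hσ.inv⟩

lemma IsPrefixReplacement.mul {σ τ : Equiv.Perm (Fin r × (ℕ → Fin n))}
    (hσ : IsPrefixReplacement σ) (hτ : IsPrefixReplacement τ) : IsPrefixReplacement (σ * τ) := by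
  rw [isPrefixReplacement_iff] at hσ hτ ⊢
  obtain ⟨k, hσ⟩ := hσ
  obtain ⟨l, hτ⟩ := hτ
  refine ⟨l + k, fun p hp => ?_⟩
  obtain ⟨p', hp'⟩ := hτ (p.1, p.2.take l) (by simp; omega)
  obtain ⟨p'', hp''⟩ := hσ.exists_of_le (p := extend p' (p.2.drop l)) (by simp; omega)
  refine ⟨p'', fun ω => ?_⟩
  rw [Equiv.Perm.mul_apply, ← hp'', conePoint_extend, ← hp', ← conePoint_extend]
  simp [extend]

lemma isPrefixReplacement_one : IsPrefixReplacement (1 : Equiv.Perm (Fin r × (ℕ → Fin n))) :=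
  ⟨0, fun q w _ => ⟨q, w, fun _ => rfl⟩⟩

end Bases

theorem higmanThompson_coCF (n r : ℕ) (hn : 2 ≤ n) (hr : 1 ≤ r) :
    ∃ X : Finset (Equiv.Perm (Fin r × (ℕ → Fin n))),
      (∀ x ∈ X, IsPrefixReplacement x) ∧
      ((Subgroup.closure (X : Set (Equiv.Perm (Fin r × (ℕ → Fin n))))) :
        Set (Equiv.Perm (Fin r × (ℕ → Fin n)))) = {σ | IsPrefixReplacement σ} ∧
      Language.IsContextFree
        {w : List (X × Bool) |
          evalWord (fun x : X => (x : Equiv.Perm (Fin r × (ℕ → Fin n)))) w ≠ 1} := by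
  have : Nontrivial (Fin n) := Fin.nontrivial_iff_two_le.2 hn
  have hfin : {σ : Equiv.Perm (Fin r × (ℕ → Fin n)) | ∃ m < r + 3 * n, HasSize m σ}.Finite := by
    refine ((Set.finite_lt_nat (r + 3 * n)).biUnion
      fun m _ => finite_setOf_hasSize (r := r) hn m).subset ?_
    rintro σ ⟨m, hm, hσ⟩
    exact Set.mem_iUnion₂.2 ⟨m, hm, hσ⟩
  have hX : ∀ x ∈ hfin.toFinset, IsPrefixReplacement x := fun x hx => by
    obtain ⟨m, -, hm⟩ := hfin.mem_toFinset.1 hx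
    exact (isPrefixReplacement_iff_hasSize hn).2 ⟨m, hm⟩
  refine ⟨hfin.toFinset, hX, Set.Subset.antisymm (fun σ hσ => ?_) fun σ hσ => ?_,
    isContextFree_evalWord_ne_one _ (fun x => hX x x.2) fun x => (hX x x.2).inv hn⟩
  · exact Subgroup.closure_induction (p := fun σ _ => IsPrefixReplacement σ) hX
      isPrefixReplacement_one (fun _ _ _ _ hσ hτ => hσ.mul hτ) (fun _ _ hσ => hσ.inv hn) hσ
  · obtain ⟨m, hm⟩ := (isPrefixReplacement_iff_hasSize hn).1 hσ
    exact hm.mem hn fun m hm σ hσ =>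
      Subgroup.subset_closure (hfin.mem_toFinset.2 ⟨m, hm, hσ⟩)
end

section
/- For every n ≥ 2, the Houghton group H_n is coCF: there exists a finite subset X of H_n with Subgroup.closure X = H_n such that the language over the alphabet X × Bool consisting of all words whose evaluation in Equiv.Perm (Fin n × ℕ) is not the identity is a context-free language. -/
/-- The underlying set of the Houghton group `H_n`, as permutations of `Fin n × ℕ`. -/
def HoughtonSet (n : ℕ) : Set (Equiv.Perm (Fin n × ℕ)) :=
  {σ | ∃ (N : ℕ) (s : Fin n → ℤ), (∑ i, s i) = 0 ∧
    ∀ (i : Fin n) (k : ℕ), N ≤ k →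
      (σ (i, k)).1 = i ∧ ((σ (i, k)).2 : ℤ) = (k : ℤ) + s i}

namespace Language

variable {T N : Type*}

/-- The words derivable in the grammar whose nonterminals are the indices of the family `I` and
whose rules are all rules (of a few simple shapes) that are sound for `I`. -/
inductive SoundDerives (I : N → Language T) : N → List T → Prop
  | nil {A : N} : [] ∈ I A → SoundDerives I A []
  | letter {A : N} {a : T} : [a] ∈ I A → SoundDerives I A [a]
  | sub {A B : N} {w : List T} (h : I B ≤ I A) : SoundDerives I B w → SoundDerives I A w
  | mul {A B C : N} {u v : List T} (h : I B * I C ≤ I A) : SoundDerives I B u → SoundDerives I C v →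
      SoundDerives I A (u ++ v)

theorem SoundDerives.mem {I : N → Language T} {A : N} {w : List T} (h : SoundDerives I A w) :
    w ∈ I A := by
  induction h with
  | nil h => exact h
  | letter h => exact h
  | sub h _ ih => exact h ih
  | mul h _ _ ih₁ ih₂ => exact h (Language.append_mem_mul ih₁ ih₂)

/-- The language of a sentential form, when nonterminals are interpreted by `I`. -/
def interp (I : N → Language T) : List (Symbol T N) → Language T
  | [] => 1
  | .terminal a :: l => {[a]} * interp I l
  | .nonterminal A :: l => I A * interp I l

theorem interp_append (I : N → Language T) (u v : List (Symbol T N)) :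
    interp I (u ++ v) = interp I u * interp I v := by
  induction u with
  | nil => simp [interp]
  | cons x u ih => cases x <;> simp [interp, ih, mul_assoc]

theorem mem_interp_map_terminal (I : N → Language T) (w : List T) :
    w ∈ interp I (w.map Symbol.terminal) := by
  induction w with
  | nil => exact Language.nil_mem_one
  | cons a w ih => exact Language.append_mem_mul (a := [a]) rfl ih

/-- The rules with right-hand side of length at most two that are sound for `I`. -/
def soundRules (I : N → Language T) : Set (ContextFreeRule T N) :=
  {r | r.output.length ≤ 2 ∧ interp I r.output ≤ I r.input}

theorem finite_soundRules [Finite T] [Finite N] (I : N → Language T) : (soundRules I).Finite := by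
  have : Finite (Symbol T N) := by
    refine Finite.of_injective (β := T ⊕ N)
      (fun x => match x with | .terminal a => .inl a | .nonterminal A => .inr A) ?_
    rintro (a | a) (b | b) h <;> simp_all
  refine Set.Finite.of_finite_image (f := fun r => (r.input, r.output))
    ((Set.finite_univ.prod (List.finite_length_le (Symbol T N) 2)).subset ?_) ?_
  · rintro _ ⟨r, hr, rfl⟩
    exact ⟨trivial, hr.1⟩
  · rintro ⟨a, b⟩ _ ⟨c, d⟩ _ h
    simp_all

/-- The grammar with all sound rules. -/
noncomputable def soundGrammar {N : Type} [Finite T] [Finite N] (I : N → Language T) (S : N) :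
    ContextFreeGrammar T :=
  ⟨N, S, (finite_soundRules I).toFinset⟩

section

variable {N : Type} [Finite T] [Finite N] {I : N → Language T} {S : N}

theorem soundGrammar_interp_le {u v : List (Symbol T N)} (h : (soundGrammar I S).Derives u v) :
    interp I v ≤ interp I u := by
  induction h with
  | refl => exact le_rfl
  | tail _ h ih =>
    obtain ⟨r, hr, hrw⟩ := h
    obtain ⟨p, q, rfl, rfl⟩ := hrw.exists_parts
    have hr' : interp I r.output ≤ interp I [.nonterminal r.input] := by
      simpa [interp] using ((finite_soundRules I).mem_toFinset.1 hr).2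
    refine le_trans ?_ ih
    have mono (p o o' q : List (Symbol T N)) (h : interp I o ≤ interp I o') :
        interp I (p ++ o ++ q) ≤ interp I (p ++ o' ++ q) := by
      simp only [interp_append]
      gcongr
    exact mono _ _ _ _ hr'

theorem SoundDerives.derives {A : N} {w : List T} (h : SoundDerives I A w) :
    (soundGrammar I S).Derives [.nonterminal A] (w.map .terminal) := by
  have key (A : N) (o : List (Symbol T N)) (ho : o.length ≤ 2) (hi : interp I o ≤ I A) :
      (soundGrammar I S).Derives [.nonterminal A] o :=
    ContextFreeGrammar.Produces.single
      ⟨⟨A, o⟩, (finite_soundRules I).mem_toFinset.2 ⟨ho, hi⟩, .input_output⟩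
  induction h with
  | nil h =>
    refine key _ [] (by simp) ?_
    rintro w rfl
    exact h
  | letter h =>
    refine key _ [.terminal _] (by simp) ?_
    simp only [interp, mul_one]
    rintro w rfl
    exact h
  | @sub A B w h _ ih => exact (key A [.nonterminal B] (by simp) (by simpa [interp] using h)).trans ih
  | @mul A B C u v h _ _ ih₁ ih₂ =>
    refine (key A [.nonterminal B, .nonterminal C] (by simp) (by simpa [interp] using h)).trans ?_
    rw [List.map_append]
    exact (ih₁.append_right [.nonterminal C]).trans (ih₂.append_left _)

/-- A member of a finite family of languages is context-free if all its words can be derived by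
sound rules. -/
theorem isContextFree_of_soundDerives (h : ∀ w ∈ I S, SoundDerives I S w) :
    (I S).IsContextFree := by
  refine ⟨soundGrammar I S, ?_⟩
  ext w
  refine ⟨fun hw => ?_, fun hw => (h w hw).derives⟩
  have h' : interp I [.nonterminal S] = I S := by simp [interp]
  exact h' ▸ soundGrammar_interp_le hw (mem_interp_map_terminal I w)

end

/-- The language of all cyclic rotations of words of `L`. -/
def cyclicClosure (L : Language T) : Language T :=
  {w | ∃ u v, w = u ++ v ∧ v ++ u ∈ L}

/-- The words `β ++ α` such that `α` and `β` surround all words of `K` to give words of `L`. -/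
def outer (L K : Language T) : Language T :=
  {w | ∃ α β, w = β ++ α ∧ ∀ y ∈ K, α ++ y ++ β ∈ L}

/-- The family `I`, extended by the languages needed to derive the cyclic closure of `I S`. -/
def cyclicFamily (I : N → Language T) (S : N) : N ⊕ N ⊕ Unit → Language T
  | .inl A => I A
  | .inr (.inl A) => outer (I S) (I A)
  | .inr (.inr _) => cyclicClosure (I S)

theorem SoundDerives.toCyclic {I : N → Language T} {S A : N} {w : List T}
    (h : SoundDerives I A w) : SoundDerives (cyclicFamily I S) (.inl A) w := by
  induction h with
  | nil h => exact .nil h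
  | letter h => exact .letter h
  | @sub A B _ h _ ih =>
    have h' : cyclicFamily I S (.inl B) ≤ cyclicFamily I S (.inl A) := h
    exact .sub h' ih
  | @mul A B C _ _ h _ _ ih₁ ih₂ =>
    have h' : cyclicFamily I S (.inl B) * cyclicFamily I S (.inl C) ≤ cyclicFamily I S (.inl A) := h
    exact .mul h' ih₁ ih₂

theorem SoundDerives.rotate {I : N → Language T} {S A : N} {w : List T}
    (h : SoundDerives I A w) (x y z : List T) (hw : w = x ++ y)
    (hz : SoundDerives (cyclicFamily I S) (.inr (.inl A)) z) :
    SoundDerives (cyclicFamily I S) (.inr (.inr ())) (y ++ (z ++ x)) := by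
  have left (A : N) : cyclicFamily I S (.inl A) * cyclicFamily I S (.inr (.inl A)) ≤
      cyclicFamily I S (.inr (.inr ())) := by
    rintro _ ⟨y, hy, _, ⟨α, β, rfl, h⟩, rfl⟩
    exact ⟨y ++ β, α, by simp, by simpa using h y hy⟩
  have right (A : N) : cyclicFamily I S (.inr (.inl A)) * cyclicFamily I S (.inl A) ≤
      cyclicFamily I S (.inr (.inr ())) := by
    rintro _ ⟨_, ⟨α, β, rfl, h⟩, y, hy, rfl⟩
    exact ⟨β, α ++ y, by simp, by simpa using h y hy⟩
  induction h generalizing x y z with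
  | @nil A h =>
    obtain ⟨rfl, rfl⟩ := List.nil_eq_append_iff.1 hw
    exact .mul (left A) (.nil h) (by simpa using hz)
  | @letter A a h =>
    obtain ⟨rfl, rfl⟩ | ⟨rfl, rfl⟩ := List.append_eq_singleton_iff.1 hw.symm
    · exact .mul (left A) (.letter h) (by simpa using hz)
    · simpa using SoundDerives.mul (right A) hz (.letter h)
  | @sub A B w h _ ih =>
    refine ih x y z hw (.sub (B := .inr (.inl A)) ?_ hz)
    rintro _ ⟨α, β, rfl, h'⟩
    exact ⟨α, β, rfl, fun y hy => h' y (h hy)⟩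
  | @mul A B C u v h hu hv ih₁ ih₂ =>
    obtain ⟨t, rfl, rfl⟩ | ⟨t, rfl, rfl⟩ := List.append_eq_append_iff.1 hw
    · have := ih₂ t y (z ++ u) rfl (.mul (B := .inr (.inl A)) (C := .inl B) ?_ hz hu.toCyclic)
      · simpa using this
      · rintro _ ⟨_, ⟨α, β, rfl, h'⟩, b, hb, rfl⟩
        exact ⟨α ++ b, β, by simp, fun c hc => by
          simpa using h' _ (h (Language.append_mem_mul hb hc))⟩
    · have := ih₁ x t (v ++ z) rfl (.mul (B := .inl C) (C := .inr (.inl A)) ?_ hv.toCyclic hz)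
      · simpa using this
      · rintro _ ⟨c, hc, _, ⟨α, β, rfl, h'⟩, rfl⟩
        exact ⟨α, c ++ β, by simp, fun b hb => by
          simpa using h' _ (h (Language.append_mem_mul hb hc))⟩

theorem isContextFree_cyclicClosure {N : Type} [Finite T] [Finite N] {I : N → Language T} {S : N}
    (h : ∀ w ∈ I S, SoundDerives I S w) : (cyclicClosure (I S)).IsContextFree := by
  refine isContextFree_of_soundDerives (I := cyclicFamily I S) (S := .inr (.inr ())) ?_
  rintro _ ⟨u, v, rfl, hw⟩
  have := (h _ hw).rotate (S := S) v u [] rfl (.nil ⟨[], [], rfl, by simp⟩)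
  simpa using this

end Language

namespace Houghton

variable {n : ℕ} {T : Type*}

/-- The letters act by maps which translate the points `(i, k)` with `k ≥ 1` by `s a i`,
where `|s a i| ≤ 1`, and take points `(i, 0)` to points of height at most one. -/
structure IsLocal (step : T → Fin n × ℕ → Fin n × ℕ) (s : T → Fin n → ℤ) : Prop where
  abs_shift_le (a : T) (i : Fin n) : |s a i| ≤ 1
  fst_eq (a : T) (i : Fin n) (k : ℕ) (hk : 1 ≤ k) : (step a (i, k)).1 = i
  snd_eq (a : T) (i : Fin n) (k : ℕ) (hk : 1 ≤ k) : ((step a (i, k)).2 : ℤ) = k + s a i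
  snd_le (a : T) (i : Fin n) : (step a (i, 0)).2 ≤ 1

/-- The action of words, the first letter acting first. -/
def run (step : T → Fin n × ℕ → Fin n × ℕ) (w : List T) (p : Fin n × ℕ) : Fin n × ℕ :=
  w.foldl (fun p a => step a p) p

@[simp] theorem run_nil (step : T → Fin n × ℕ → Fin n × ℕ) (p : Fin n × ℕ) :
    run step [] p = p := rfl

@[simp] theorem run_cons (step : T → Fin n × ℕ → Fin n × ℕ) (a : T) (w : List T)
    (p : Fin n × ℕ) : run step (a :: w) p = run step w (step a p) := rfl

@[simp] theorem run_append (step : T → Fin n × ℕ → Fin n × ℕ) (u v : List T) (p : Fin n × ℕ) :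
    run step (u ++ v) p = run step v (run step u p) := by
  simp [run]

/-- Indices of the languages used to follow the orbit of a point `(i, 0)`. -/
inductive Track (n : ℕ) (T : Type*)
  | zero (i j : Fin n)
  | one (i j : Fin n)
  | pos (i j : Fin n)
  | up (j : Fin n)
  | stay (j : Fin n)
  | letter (a : T)
  | moved

instance [Finite T] : Finite (Track n T) := by
  refine Finite.of_injective
    (β := (Fin n × Fin n) ⊕ (Fin n × Fin n) ⊕ (Fin n × Fin n) ⊕ Fin n ⊕ Fin n ⊕ T ⊕ Unit)
    (fun x => match x with
      | .zero i j => .inl (i, j)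
      | .one i j => .inr (.inl (i, j))
      | .pos i j => .inr (.inr (.inl (i, j)))
      | .up j => .inr (.inr (.inr (.inl j)))
      | .stay j => .inr (.inr (.inr (.inr (.inl j))))
      | .letter a => .inr (.inr (.inr (.inr (.inr (.inl a)))))
      | .moved => .inr (.inr (.inr (.inr (.inr (.inr ())))))) ?_
  rintro (_ | _ | _ | _ | _ | _ | _) (_ | _ | _ | _ | _ | _ | _) h <;> simp_all

/-- The language of words moving some point of the form `(i, 0)`, and auxiliary languages. -/
def trackLang (step : T → Fin n × ℕ → Fin n × ℕ) : Track n T → Language T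
  | .zero i j => {w | run step w (i, 0) = (j, 0)}
  | .one i j => {w | run step w (i, 0) = (j, 1)}
  | .pos i j => {w | ∃ k, run step w (i, 0) = (j, k + 1)}
  | .up j => {w | ∀ k, run step w (j, k + 1) = (j, k + 2)}
  | .stay j => {w | ∀ k, run step w (j, k + 1) = (j, k + 1)}
  | .letter a => {[a]}
  | .moved => {w | ∃ i, run step w (i, 0) ≠ (i, 0)}

open Language

/-- Words leading from `(i, 0)` to `(j, m)` with `m ≥ 1`, decomposed at the last times the heights
`1, …, m - 1` are left. -/
inductive Climb (step : T → Fin n × ℕ → Fin n × ℕ) (i j : Fin n) : ℕ → List T → Prop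
  | one {w : List T} : SoundDerives (trackLang step) (.one i j) w → Climb step i j 1 w
  | push {m : ℕ} {x y : List T} : Climb step i j m x →
      SoundDerives (trackLang step) (.up j) y → Climb step i j (m + 1) (x ++ y)

variable {step : T → Fin n × ℕ → Fin n × ℕ} {s : T → Fin n → ℤ}

theorem Climb.pos {i j : Fin n} {m : ℕ} {w : List T} (h : Climb step i j m w) : 1 ≤ m := by
  cases h <;> omega

theorem Climb.stay {i j : Fin n} {m : ℕ} {x y : List T} (h : Climb step i j m x)
    (hy : SoundDerives (trackLang step) (.stay j) y) : Climb step i j m (x ++ y) := by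
  cases h with
  | one h =>
    refine .one (.mul ?_ h hy)
    rintro _ ⟨u, hu, v, hv, rfl⟩
    have hu : run step u (i, 0) = (j, 1) := hu
    have hv : ∀ k, run step v (j, k + 1) = (j, k + 1) := hv
    change run step (u ++ v) (i, 0) = (j, 1)
    rw [run_append, hu, hv 0]
  | push h h' =>
    rw [List.append_assoc]
    refine .push h (.mul ?_ h' hy)
    rintro _ ⟨u, hu, v, hv, rfl⟩ k
    have hu : ∀ k, run step u (j, k + 1) = (j, k + 2) := hu
    have hv : ∀ k, run step v (j, k + 1) = (j, k + 1) := hv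
    change run step (u ++ v) _ = _
    rw [run_append, hu, hv]

theorem Climb.soundDerives {i j : Fin n} {m : ℕ} {w : List T} (h : Climb step i j m w) :
    SoundDerives (trackLang step) (.pos i j) w := by
  induction h with
  | one h =>
    refine .sub ?_ h
    intro w hw
    exact ⟨0, hw⟩
  | push h h' ih =>
    refine .mul ?_ ih h'
    rintro _ ⟨u, ⟨k, hu⟩, v, hv, rfl⟩
    have hv : ∀ k, run step v (j, k + 1) = (j, k + 2) := hv
    exact ⟨k + 1, by simp [hu, hv]⟩

theorem IsLocal.step_eq (hl : IsLocal step s) {a : T} {j : Fin n} {k l : ℕ} (hk : 1 ≤ k)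
    (h : (l : ℤ) = k + s a j) : step a (j, k) = (j, l) := by
  refine Prod.ext (hl.fst_eq a j k hk) ?_
  have := hl.snd_eq a j k hk
  dsimp only
  omega

theorem IsLocal.soundDerives_or_climb (hl : IsLocal step s) (i : Fin n) (w : List T) (j : Fin n)
    (l : ℕ) (h : run step w (i, 0) = (j, l)) :
    (l = 0 ∧ SoundDerives (trackLang step) (.zero i j) w) ∨ Climb step i j l w := by
  have der (a : T) : SoundDerives (trackLang step) (.letter a) [a] := .letter rfl
  induction w using List.reverseRecOn generalizing j l with
  | nil =>
    simp only [run_nil, Prod.mk.injEq] at h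
    obtain ⟨rfl, rfl⟩ := h
    exact .inl ⟨rfl, .nil rfl⟩
  | append_singleton w a ih =>
    obtain ⟨j', l', hw⟩ : ∃ j' l', run step w (i, 0) = (j', l') := ⟨_, _, rfl⟩
    rw [run_append, hw, run_cons, run_nil] at h
    obtain ⟨rfl, hd⟩ | hc := ih _ _ hw
    · have h1 := hl.snd_le a j'
      simp only [h] at h1
      obtain rfl | rfl : l = 0 ∨ l = 1 := by omega
      · refine .inl ⟨rfl, .mul ?_ hd (der a)⟩
        rintro _ ⟨u, hu, _, rfl, rfl⟩
        have hu : run step u (i, 0) = (j', 0) := hu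
        change run step (u ++ [a]) (i, 0) = (j, 0)
        simp [hu, h]
      · refine .inr (.one (.mul ?_ hd (der a)))
        rintro _ ⟨u, hu, _, rfl, rfl⟩
        have hu : run step u (i, 0) = (j', 0) := hu
        change run step (u ++ [a]) (i, 0) = (j, 1)
        simp [hu, h]
    · have hpos := hc.pos
      have e1 := hl.fst_eq a j' l' hpos
      have e2 := hl.snd_eq a j' l' hpos
      rw [h] at e1 e2
      dsimp only at e1 e2
      subst e1
      obtain hs | hs | hs : s a j = 1 ∨ s a j = 0 ∨ s a j = -1 := by
        have := abs_le.1 (hl.abs_shift_le a j)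
        omega
      · obtain rfl : l = l' + 1 := by omega
        refine .inr (.push hc (.letter ?_))
        intro k
        exact hl.step_eq (by omega) (by push_cast; omega)
      · obtain rfl : l = l' := by omega
        refine .inr (hc.stay (.letter ?_))
        intro k
        exact hl.step_eq (by omega) (by push_cast; omega)
      · cases hc with
        | one hd =>
          obtain rfl : l = 0 := by omega
          refine .inl ⟨rfl, .mul ?_ hd (der a)⟩
          rintro _ ⟨u, hu, _, rfl, rfl⟩
          have hu : run step u (i, 0) = (j, 1) := hu
          change run step (u ++ [a]) (i, 0) = (j, 0)
          simp [hu, h]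
        | @push m x y hc hd =>
          obtain rfl : l = m := by omega
          rw [List.append_assoc]
          refine .inr (hc.stay (.mul ?_ hd (der a)))
          rintro _ ⟨u, hu, _, rfl, rfl⟩ k
          have hu : ∀ k, run step u (j, k + 1) = (j, k + 2) := hu
          change run step (u ++ [a]) _ = _
          rw [run_append, hu]
          exact hl.step_eq (by omega) (by push_cast; omega)

theorem IsLocal.soundDerives_moved (hl : IsLocal step s) (w : List T)
    (hw : w ∈ trackLang step .moved) : SoundDerives (trackLang step) .moved w := by
  obtain ⟨i, hi⟩ := hw
  obtain ⟨j, l, h⟩ : ∃ j l, run step w (i, 0) = (j, l) := ⟨_, _, rfl⟩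
  obtain ⟨rfl, hd⟩ | hc := hl.soundDerives_or_climb i w j l h
  · refine .sub ?_ hd
    intro u (hu : run step u (i, 0) = (j, 0))
    exact ⟨i, by rwa [hu, ← h]⟩
  · refine .sub ?_ hc.soundDerives
    rintro u ⟨k, hu⟩
    exact ⟨i, by simp [hu]⟩

/-- The total translation of a word along the ray `i`. -/
def shift (s : T → Fin n → ℤ) (w : List T) (i : Fin n) : ℤ :=
  (w.map fun a => s a i).sum

theorem IsLocal.run_of_length_le (hl : IsLocal step s) (w : List T) (i : Fin n) (k : ℕ)
    (hk : w.length ≤ k) :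
    (run step w (i, k)).1 = i ∧ ((run step w (i, k)).2 : ℤ) = k + shift s w i := by
  induction w generalizing k with
  | nil => simp [shift]
  | cons a w ih =>
    simp only [List.length_cons] at hk
    have h2 := hl.snd_eq a i k (by omega)
    have h3 := abs_le.1 (hl.abs_shift_le a i)
    obtain ⟨l, hl'⟩ : ∃ l : ℕ, (l : ℤ) = k + s a i := ⟨_, h2⟩
    rw [run_cons, hl.step_eq (by omega) hl']
    have := ih l (by omega)
    refine ⟨this.1, ?_⟩
    rw [this.2, hl']
    simp [shift, add_assoc]

theorem IsLocal.run_eq_or_hits (hl : IsLocal step s) (w : List T) (i : Fin n) (k : ℕ) :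
    (∃ u v j, w = u ++ v ∧ run step u (i, k) = (j, 0)) ∨
    ((run step w (i, k)).1 = i ∧ ((run step w (i, k)).2 : ℤ) = k + shift s w i) := by
  induction w generalizing k with
  | nil => simp [shift]
  | cons a w ih =>
    obtain rfl | hk := Nat.eq_zero_or_pos k
    · exact .inl ⟨[], a :: w, i, rfl, rfl⟩
    have h2 := hl.snd_eq a i k hk
    obtain ⟨l, hl'⟩ : ∃ l : ℕ, (l : ℤ) = k + s a i := ⟨_, h2⟩
    have h4 := hl.step_eq hk hl'
    rw [run_cons, h4]
    obtain ⟨u, v, j, rfl, h⟩ | h := ih l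
    · exact .inl ⟨a :: u, v, j, rfl, by rw [run_cons, h4, h]⟩
    · refine .inr ⟨h.1, ?_⟩
      rw [h.2, hl']
      simp [shift, add_assoc]

/-- A word acts nontrivially if and only if one of its cyclic rotations moves a point `(i, 0)`. -/
theorem IsLocal.mem_cyclicClosure_iff (hl : IsLocal step s)
    (hinj : ∀ a, Function.Injective (step a)) (w : List T) (hsum : ∑ i, shift s w i = 0) :
    w ∈ cyclicClosure (trackLang step .moved) ↔ ∃ p, run step w p ≠ p := by
  have inj (u : List T) : Function.Injective (run step u) := by
    induction u with
    | nil => exact fun _ _ h => h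
    | cons a u ih => exact ih.comp (hinj a)
  constructor
  · rintro ⟨u, v, rfl, i, hi⟩
    by_contra! h
    have hv := h (run step v (i, 0))
    apply hi
    have : run step v (run step (v ++ u) (i, 0)) = run step v (i, 0) := by
      simpa using hv
    exact inj v this
  · intro hp
    by_contra hw
    have fix (i : Fin n) (k : ℕ) : run step w (i, k) = (i, k) ∨
        ((run step w (i, k)).1 = i ∧ ((run step w (i, k)).2 : ℤ) = k + shift s w i) := by
      refine (hl.run_eq_or_hits w i k).imp_left ?_
      rintro ⟨u, v, j, rfl, hu⟩
      by_contra hne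
      refine hw ⟨u, v, rfl, j, fun h => hne (inj u ?_)⟩
      simpa [hu] using h
    have nonneg (i : Fin n) : 0 ≤ shift s w i := by
      by_contra! hneg
      have ex : ∃ k, run step w (i, k) ≠ (i, k) := by
        refine ⟨w.length, fun h => ?_⟩
        have := (hl.run_of_length_le w i w.length le_rfl).2
        rw [h] at this
        dsimp only at this
        omega
      classical
      have hk := Nat.find_spec ex
      obtain ⟨h1, h2⟩ := (fix i (Nat.find ex)).resolve_left hk
      obtain ⟨l, hl'⟩ : ∃ l, l = (run step w (i, Nat.find ex)).2 := ⟨_, rfl⟩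
      have hr : run step w (i, Nat.find ex) = (i, l) := Prod.ext h1 hl'.symm
      have hlt : l < Nat.find ex := by omega
      have := Nat.find_min ex hlt
      push Not at this
      have := inj w (hr.trans this.symm)
      simp only [Prod.mk.injEq, true_and] at this
      omega
    have zero (i : Fin n) : shift s w i = 0 :=
      (Finset.sum_eq_zero_iff_of_nonneg fun i _ => nonneg i).1 hsum i (Finset.mem_univ i)
    obtain ⟨⟨i, k⟩, hik⟩ := hp
    obtain h | ⟨h1, h2⟩ := fix i k
    · exact hik h
    · refine hik (Prod.ext h1 ?_)
      rw [zero] at h2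
      dsimp only
      omega

end Houghton

namespace Houghton

open Equiv

variable {n : ℕ}

/-- `σ` translates the `i`-th ray by `s i`, up to finitely many points. -/
def TranslatesBy (σ : Perm (Fin n × ℕ)) (s : Fin n → ℤ) : Prop :=
  ∃ N : ℕ, ∀ (i : Fin n) (k : ℕ), N ≤ k →
    (σ (i, k)).1 = i ∧ ((σ (i, k)).2 : ℤ) = (k : ℤ) + s i

theorem mem_houghtonSet_iff {σ : Perm (Fin n × ℕ)} :
    σ ∈ HoughtonSet n ↔ ∃ s, ∑ i, s i = 0 ∧ TranslatesBy σ s :=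
  ⟨fun ⟨N, s, h0, h⟩ => ⟨s, h0, N, h⟩, fun ⟨s, h0, N, h⟩ => ⟨N, s, h0, h⟩⟩

theorem TranslatesBy.one : TranslatesBy (1 : Perm (Fin n × ℕ)) 0 :=
  ⟨0, by simp⟩

theorem exists_natAbs_le (s : Fin n → ℤ) : ∃ M : ℕ, ∀ i, (s i).natAbs ≤ M :=
  ⟨∑ i, (s i).natAbs, fun i =>
    Finset.single_le_sum (f := fun i => (s i).natAbs) (fun _ _ => Nat.zero_le _)
      (Finset.mem_univ i)⟩

theorem TranslatesBy.mul {σ τ : Perm (Fin n × ℕ)} {s t : Fin n → ℤ} (hσ : TranslatesBy σ s)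
    (hτ : TranslatesBy τ t) : TranslatesBy (σ * τ) (s + t) := by
  obtain ⟨N, hN⟩ := hσ
  obtain ⟨N', hN'⟩ := hτ
  obtain ⟨M, hM⟩ := exists_natAbs_le t
  refine ⟨N + N' + M, fun i k hk => ?_⟩
  obtain ⟨h1, h2⟩ := hN' i k (by omega)
  have hMi := hM i
  obtain ⟨h3, h4⟩ := hN i (τ (i, k)).2 (by omega)
  have : (i, (τ (i, k)).2) = τ (i, k) := Prod.ext h1.symm rfl
  rw [this] at h3 h4
  refine ⟨h3, ?_⟩
  rw [Perm.mul_apply, h4, h2, Pi.add_apply]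
  ring

theorem TranslatesBy.inv {σ : Perm (Fin n × ℕ)} {s : Fin n → ℤ} (hσ : TranslatesBy σ s) :
    TranslatesBy σ⁻¹ (-s) := by
  obtain ⟨N, hN⟩ := hσ
  obtain ⟨M, hM⟩ := exists_natAbs_le s
  refine ⟨N + M, fun i k hk => ?_⟩
  have hMi := hM i
  obtain ⟨l, hl⟩ : ∃ l : ℕ, (l : ℤ) = k - s i := ⟨(k - s i).toNat, by omega⟩
  obtain ⟨h1, h2⟩ := hN i l (by omega)
  have : σ (i, l) = (i, k) := Prod.ext h1 (by dsimp only; omega)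
  rw [Perm.inv_eq_iff_eq.2 this.symm]
  exact ⟨rfl, by simp [hl, sub_eq_add_neg]⟩

/-- The Houghton group. -/
def houghtonGroup (n : ℕ) : Subgroup (Perm (Fin n × ℕ)) where
  carrier := HoughtonSet n
  one_mem' := mem_houghtonSet_iff.2 ⟨0, by simp, .one⟩
  mul_mem' hσ hτ := by
    obtain ⟨s, hs, h⟩ := mem_houghtonSet_iff.1 hσ
    obtain ⟨t, ht, h'⟩ := mem_houghtonSet_iff.1 hτ
    exact mem_houghtonSet_iff.2 ⟨s + t, by simp [Finset.sum_add_distrib, hs, ht], h.mul h'⟩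
  inv_mem' hσ := by
    obtain ⟨s, hs, h⟩ := mem_houghtonSet_iff.1 hσ
    exact mem_houghtonSet_iff.2 ⟨-s, by simp [hs], h.inv⟩

/-- The map moving ray `i` one step towards the origin and ray `j` one step outwards. -/
def slideFun (i j : Fin n) (p : Fin n × ℕ) : Fin n × ℕ :=
  if p.1 = i then (if p.2 = 0 then (j, 0) else (i, p.2 - 1))
  else if p.1 = j then (j, p.2 + 1) else p

theorem slideFun_slideFun {i j : Fin n} (h : i ≠ j) (p : Fin n × ℕ) :
    slideFun j i (slideFun i j p) = p := by
  obtain ⟨x, k⟩ := p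
  by_cases hx : x = i
  · subst hx
    obtain _ | k := k <;> simp [slideFun, h]
  · by_cases hy : x = j
    · subst hy
      simp [slideFun, hx]
    · simp [slideFun, hx, hy]

/-- The permutation moving ray `i` one step towards the origin and ray `j` one step outwards. -/
def slide (i j : Fin n) (h : i ≠ j) : Perm (Fin n × ℕ) :=
  ⟨slideFun i j, slideFun j i, slideFun_slideFun h, slideFun_slideFun h.symm⟩

theorem slide_inv (i j : Fin n) (h : i ≠ j) : (slide i j h)⁻¹ = slide j i h.symm := rfl

/-- A finite generating set of the Houghton group. -/
def generators (n : ℕ) : Set (Perm (Fin n × ℕ)) :=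
  Set.range (fun p : {p : Fin n × Fin n // p.1 ≠ p.2} => slide p.1.1 p.1.2 p.2) ∪
    Set.range (fun p : Fin n × Fin n => swap (p.1, 0) (p.2, 0))

theorem finite_generators (n : ℕ) : (generators n).Finite :=
  (Set.finite_range _).union (Set.finite_range _)

/-- Permutations which are translations, by steps of length at most one, at all points `(i, k)`
with `k ≥ 1`, and which take points `(i, 0)` to points of height at most one. -/
def IsShort (σ : Perm (Fin n × ℕ)) (s : Fin n → ℤ) : Prop :=
  ∑ i, s i = 0 ∧ (∀ i, |s i| ≤ 1) ∧
    (∀ (i : Fin n) (k : ℕ), 1 ≤ k → (σ (i, k)).1 = i ∧ ((σ (i, k)).2 : ℤ) = k + s i) ∧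
    ∀ i, (σ (i, 0)).2 ≤ 1

theorem isShort_slide {i j : Fin n} (h : i ≠ j) :
    IsShort (slide i j h) (Pi.single j 1 - Pi.single i 1) := by
  refine ⟨by simp, fun x => ?_, fun x k hk => ?_, fun x => ?_⟩
  · by_cases hx : x = i
    · subst hx; simp [h]
    · by_cases hy : x = j
      · subst hy; simp [hx]
      · simp [hx, hy]
  · obtain ⟨k, rfl⟩ := Nat.exists_eq_add_of_le' hk
    by_cases hx : x = i
    · subst hx; simp [slide, slideFun, h]
    · by_cases hy : x = j
      · subst hy; simp [slide, slideFun, hx]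
      · simp [slide, slideFun, hx, hy]
  · simp only [slide, slideFun, Equiv.coe_fn_mk]
    split_ifs <;> simp

theorem isShort_swap (i j : Fin n) : IsShort (swap ((i, 0) : Fin n × ℕ) (j, 0)) 0 := by
  refine ⟨by simp, by simp, fun x k hk => ?_, fun x => ?_⟩
  · rw [swap_apply_of_ne_of_ne (by simp; omega) (by simp; omega)]
    simp
  · rw [swap_apply_def]
    split_ifs <;> simp

theorem exists_isShort {σ : Perm (Fin n × ℕ)} (hσ : σ ∈ generators n) :
    (∃ s, IsShort σ s) ∧ ∃ s, IsShort σ⁻¹ s := by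
  obtain ⟨⟨⟨i, j⟩, h⟩, rfl⟩ | ⟨⟨i, j⟩, rfl⟩ := hσ
  · exact ⟨⟨_, isShort_slide h⟩, by rw [slide_inv]; exact ⟨_, isShort_slide h.symm⟩⟩
  · exact ⟨⟨_, isShort_swap i j⟩, by rw [swap_inv]; exact ⟨_, isShort_swap i j⟩⟩

theorem generators_subset : generators n ⊆ HoughtonSet n := by
  intro σ hσ
  obtain ⟨s, h0, -, h, -⟩ := (exists_isShort hσ).1
  exact ⟨1, s, h0, h⟩

theorem swap_mem_closure_generators (hn : 2 ≤ n) (p q : Fin n × ℕ) :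
    swap p q ∈ Subgroup.closure (generators n) := by
  have : Nontrivial (Fin n) := Fin.nontrivial_iff_two_le.2 hn
  have base (i j : Fin n) : swap (i, 0) (j, 0) ∈ Subgroup.closure (generators n) :=
    Subgroup.subset_closure (.inr ⟨(i, j), rfl⟩)
  have hslide (i j : Fin n) (h : i ≠ j) : slide i j h ∈ Subgroup.closure (generators n) :=
    Subgroup.subset_closure (.inl ⟨⟨(i, j), h⟩, rfl⟩)
  have conj {g : Perm (Fin n × ℕ)} {a b : Fin n × ℕ} (hg : g ∈ Subgroup.closure (generators n))
      (hab : swap a b ∈ Subgroup.closure (generators n)) :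
      swap (g a) (g b) ∈ Subgroup.closure (generators n) := by
    rw [swap_apply_apply]
    exact mul_mem (mul_mem hg hab) (inv_mem hg)
  have succ (j : Fin n) (k : ℕ) :
      swap (j, k) (j, k + 1) ∈ Subgroup.closure (generators n) := by
    obtain ⟨i, hi⟩ := exists_ne j
    induction k with
    | zero => simpa [slide, slideFun, hi.symm] using conj (hslide i j hi) (base i j)
    | succ k ih => simpa [slide, slideFun, hi.symm] using conj (hslide i j hi) ih
  have origin (j : Fin n) (k : ℕ) :
      swap (j, 0) (j, k) ∈ Subgroup.closure (generators n) := by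
    induction k with
    | zero => exact base j j
    | succ k ih => exact SubmonoidClass.swap_mem_trans _ ih (succ j k)
  obtain ⟨i, k⟩ := p
  obtain ⟨j, l⟩ := q
  refine SubmonoidClass.swap_mem_trans _ ?_ (origin j l)
  refine SubmonoidClass.swap_mem_trans _ ?_ (base i j)
  rw [swap_comm]
  exact origin i k

theorem mem_closure_generators_of_translatesBy_zero (hn : 2 ≤ n) {σ : Perm (Fin n × ℕ)}
    (h : TranslatesBy σ 0) : σ ∈ Subgroup.closure (generators n) := by
  obtain ⟨N, hN⟩ := h
  have : σ ∈ Subgroup.closure {τ : Perm (Fin n × ℕ) | τ.IsSwap} := by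
    refine mem_closure_isSwap'.2 ((Set.finite_univ.prod (Set.finite_lt_nat N)).subset ?_)
    rintro ⟨i, k⟩ hik
    refine ⟨trivial, ?_⟩
    by_contra! hk
    obtain ⟨h1, h2⟩ := hN i k (by simpa using hk)
    exact hik (Prod.ext h1 (by simpa using h2))
  refine (Subgroup.closure_le _).2 ?_ this
  rintro _ ⟨p, q, -, rfl⟩
  exact swap_mem_closure_generators hn p q

/-- The translation vectors of elements of a subgroup. -/
def translations (K : Subgroup (Perm (Fin n × ℕ))) : AddSubgroup (Fin n → ℤ) where
  carrier := {s | ∃ g ∈ K, TranslatesBy g s}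
  zero_mem' := ⟨1, K.one_mem, .one⟩
  add_mem' := by
    rintro s t ⟨g, hg, hs⟩ ⟨g', hg', ht⟩
    exact ⟨g * g', K.mul_mem hg hg', hs.mul ht⟩
  neg_mem' := by
    rintro s ⟨g, hg, hs⟩
    exact ⟨g⁻¹, K.inv_mem hg, hs.inv⟩

theorem mem_translations_closure_generators (hn : 2 ≤ n) {s : Fin n → ℤ} (hs : ∑ i, s i = 0) :
    s ∈ translations (Subgroup.closure (generators n)) := by
  let i₀ : Fin n := ⟨0, by omega⟩
  have hsum : s = ∑ j, s j • ((Pi.single j 1 : Fin n → ℤ) - Pi.single i₀ 1) := by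
    simp only [smul_sub, Finset.sum_sub_distrib, ← Finset.sum_smul, hs, zero_smul, sub_zero]
    exact (pi_eq_sum_univ' s).trans (by simp)
  rw [hsum]
  refine AddSubgroup.sum_mem _ fun j _ => AddSubgroup.zsmul_mem _ ?_ _
  by_cases h : i₀ = j
  · rw [h, sub_self]
    exact zero_mem _
  · exact ⟨slide i₀ j h, Subgroup.subset_closure (.inl ⟨⟨(i₀, j), h⟩, rfl⟩), 1,
      (isShort_slide h).2.2.1⟩

theorem closure_generators (hn : 2 ≤ n) :
    (Subgroup.closure (generators n) : Set (Perm (Fin n × ℕ))) = HoughtonSet n := by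
  refine Set.Subset.antisymm ((Subgroup.closure_le (houghtonGroup n)).2 generators_subset) ?_
  intro σ hσ
  obtain ⟨s, hs, h⟩ := mem_houghtonSet_iff.1 hσ
  obtain ⟨g, hg, h'⟩ := mem_translations_closure_generators hn hs
  have := mem_closure_generators_of_translatesBy_zero hn (σ := g⁻¹ * σ) (by
    simpa using h'.inv.mul h)
  simpa using mul_mem hg this

/-- The action of signed words over a set of permutations in terms of the inverses of the
letters. -/
theorem run_eq_evalWord_inv {A : Type*} (f : A → Perm (Fin n × ℕ)) (w : List (A × Bool))
    (p : Fin n × ℕ) :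
    run (fun a : A × Bool => ⇑(if a.2 then f a.1 else (f a.1)⁻¹)⁻¹) w p = (evalWord f w)⁻¹ p := by
  induction w generalizing p with
  | nil => simp [evalWord]
  | cons a w ih =>
    rw [run_cons, ih, ← Perm.mul_apply, ← mul_inv_rev]
    rfl

end Houghton

theorem houghton_coCF (n : ℕ) (hn : 2 ≤ n) :
    ∃ X : Finset (Equiv.Perm (Fin n × ℕ)),
      (X : Set (Equiv.Perm (Fin n × ℕ))) ⊆ HoughtonSet n ∧
      ((Subgroup.closure (X : Set (Equiv.Perm (Fin n × ℕ)))) :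
        Set (Equiv.Perm (Fin n × ℕ))) = HoughtonSet n ∧
      Language.IsContextFree
        {w : List (X × Bool) |
          evalWord (fun x : X => (x : Equiv.Perm (Fin n × ℕ))) w ≠ 1} := by
  refine ⟨(Houghton.finite_generators n).toFinset, ?_, ?_, ?_⟩
  · simpa using Houghton.generators_subset
  · simpa using Houghton.closure_generators hn
  set X := (Houghton.finite_generators n).toFinset
  let f : X → Equiv.Perm (Fin n × ℕ) := fun x => x
  have short (a : X × Bool) : ∃ s, Houghton.IsShort (if a.2 then f a.1 else (f a.1)⁻¹)⁻¹ s := by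
    obtain ⟨⟨x, hx⟩, b⟩ := a
    have := Houghton.exists_isShort ((Houghton.finite_generators n).mem_toFinset.1 hx)
    cases b
    · simpa [f] using this.1
    · simpa [f] using this.2
  choose s hs using short
  have hl : Houghton.IsLocal
      (fun a : X × Bool => ⇑(if a.2 then f a.1 else (f a.1)⁻¹)⁻¹) s :=
    { abs_shift_le := fun a => (hs a).2.1
      fst_eq := fun a i k hk => ((hs a).2.2.1 i k hk).1
      snd_eq := fun a i k hk => ((hs a).2.2.1 i k hk).2
      snd_le := fun a => (hs a).2.2.2 }
  have hsum (w : List (X × Bool)) : ∑ i, Houghton.shift s w i = 0 := by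
    induction w with
    | nil => simp [Houghton.shift]
    | cons a w ih =>
      simp only [Houghton.shift] at ih
      simp [Houghton.shift, Finset.sum_add_distrib, (hs a).1, ih]
  refine (congrArg Language.IsContextFree (Set.ext fun w => ?_)).mpr
    (Language.isContextFree_cyclicClosure hl.soundDerives_moved)
  refine Iff.trans ?_ (hl.mem_cyclicClosure_iff (fun a => Equiv.injective _) w (hsum w)).symm
  simp only [Houghton.run_eq_evalWord_inv]
  change evalWord f w ≠ 1 ↔ _
  rw [ne_eq, ← inv_eq_one, Equiv.ext_iff, not_forall]
  rfl
end

section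
/- Let τ : Equiv.Perm ℤ be the transposition swapping 0 and 1, and let t : Equiv.Perm ℤ be the translation k ↦ k + 1. Then the language over the two-letter signed alphabet Fin 2 × Bool, where letter 0 is mapped to τ and letter 1 is mapped to t, consisting of all words whose evaluation in Equiv.Perm ℤ is not the identity permutation, is a context-free language. (This is the co-word problem of the Houghton group H_2 with respect to the generating set {τ, t}.) -/
/-- The generators of `H₂`: letter `0` is the transposition `0 ↔ 1`, letter `1` is the
translation `k ↦ k + 1`. -/
def H2gen : Fin 2 → Equiv.Perm ℤ :=
  ![Equiv.swap (0 : ℤ) 1, Equiv.addRight (1 : ℤ)]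

namespace ContextFreeGrammar

variable {T N : Type*}

/-- The words obtained from a sentential form by substituting, for every occurrence of a
nonterminal `A`, some word satisfying `I A`. -/
def Fills (I : N → List T → Prop) : List (Symbol T N) → List T → Prop
  | [], w => w = []
  | .terminal a :: s, w => ∃ v, w = a :: v ∧ Fills I s v
  | .nonterminal A :: s, w => ∃ u v, w = u ++ v ∧ I A u ∧ Fills I s v

lemma fills_append {I : N → List T → Prop} {s₁ s₂ : List (Symbol T N)} {w : List T} :
    Fills I (s₁ ++ s₂) w ↔ ∃ u v, w = u ++ v ∧ Fills I s₁ u ∧ Fills I s₂ v := by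
  induction s₁ generalizing w with
  | nil => simp [Fills]
  | cons x s ih =>
    cases x with
    | terminal a =>
      simp only [List.cons_append, Fills, ih]
      constructor
      · rintro ⟨_, rfl, u, v, rfl, hu, hv⟩
        exact ⟨a :: u, v, rfl, ⟨u, rfl, hu⟩, hv⟩
      · rintro ⟨_, v, rfl, ⟨u, rfl, hu⟩, hv⟩
        exact ⟨_, rfl, u, v, rfl, hu, hv⟩
    | nonterminal A =>
      simp only [List.cons_append, Fills, ih]
      constructor
      · rintro ⟨x, _, rfl, hx, u, v, rfl, hu, hv⟩
        exact ⟨x ++ u, v, by simp, ⟨x, u, rfl, hx, hu⟩, hv⟩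
      · rintro ⟨_, v, rfl, ⟨x, u, rfl, hx, hu⟩, hv⟩
        exact ⟨x, u ++ v, by simp, hx, u, v, rfl, hu, hv⟩

lemma fills_map_terminal (I : N → List T → Prop) (w : List T) :
    Fills I (w.map Symbol.terminal) w := by
  induction w with
  | nil => rfl
  | cons a w ih => exact ⟨w, rfl, ih⟩

lemma Derives.fills {g : ContextFreeGrammar T} {I : g.NT → List T → Prop}
    (hI : ∀ r ∈ g.rules, ∀ w, Fills I r.output w → I r.input w)
    {s₁ s₂ : List (Symbol T g.NT)} (h : g.Derives s₁ s₂) {w : List T} (hw : Fills I s₂ w) :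
    Fills I s₁ w := by
  induction h with
  | refl => exact hw
  | tail _ h ih =>
    obtain ⟨r, hr, hrw⟩ := h
    obtain ⟨p, q, rfl, rfl⟩ := hrw.exists_parts
    apply ih
    simp only [fills_append] at hw ⊢
    obtain ⟨_, v, rfl, ⟨u, x, rfl, hu, hx⟩, hv⟩ := hw
    exact ⟨_, v, rfl, ⟨u, x, rfl, hu, x, [], by simp, hI r hr x hx, rfl⟩, hv⟩

/-- The word `w` can be derived from the nonterminal `A`. -/
def DerivesWord (g : ContextFreeGrammar T) (A : g.NT) (w : List T) : Prop :=
  g.Derives [.nonterminal A] (w.map Symbol.terminal)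

/-- A property of words closed under all the rules holds for all derivable words. -/
lemma DerivesWord.induction {g : ContextFreeGrammar T} {I : g.NT → List T → Prop}
    (hI : ∀ r ∈ g.rules, ∀ w, Fills I r.output w → I r.input w)
    {A : g.NT} {w : List T} (h : g.DerivesWord A w) : I A w := by
  obtain ⟨u, v, rfl, hu, rfl⟩ := Derives.fills hI h (fills_map_terminal I w)
  simpa using hu

lemma derives_of_fills {g : ContextFreeGrammar T} {s : List (Symbol T g.NT)} {w : List T}
    (h : Fills g.DerivesWord s w) : g.Derives s (w.map Symbol.terminal) := by
  induction s generalizing w with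
  | nil => cases h; rfl
  | cons x s ih =>
    cases x with
    | terminal a =>
      obtain ⟨v, rfl, hv⟩ := h
      exact (ih hv).append_left [.terminal a]
    | nonterminal A =>
      obtain ⟨u, v, rfl, hu, hv⟩ := h
      rw [List.map_append]
      exact (hu.append_right s).trans ((ih hv).append_left _)

lemma derivesWord_of_fills {g : ContextFreeGrammar T} {A : g.NT} {s : List (Symbol T g.NT)}
    (hr : ⟨A, s⟩ ∈ g.rules) {w : List T} (h : Fills g.DerivesWord s w) : g.DerivesWord A w := by
  refine Produces.trans_derives ⟨⟨A, s⟩, hr, ?_⟩ (derives_of_fills h)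
  exact ContextFreeRule.Rewrites.input_output

end ContextFreeGrammar

namespace Houghton2

open ContextFreeGrammar

/-- The permutation of `ℤ` represented by a word. -/
local notation "ev" => evalWord H2gen

/-- The permutation of `ℤ` represented by a letter. -/
def letter (a : Fin 2 × Bool) : Equiv.Perm ℤ := if a.2 then H2gen a.1 else (H2gen a.1)⁻¹

/-- The integers split into the half-lines `{1, 2, …}` (`s = true`) and `{0, -1, …}`
(`s = false`); `pos s h` is the point at distance `h` from the end of the half-line `s`. -/
def pos (s : Bool) (h : ℕ) : ℤ := if s then 1 + h else -h

/-- The letter moving the points of the half-line `s` away from its end. -/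
abbrev shift (s : Bool) : Fin 2 × Bool := (1, s)

/-- The letter `τ` or its formal inverse. -/
abbrev flip (b : Bool) : Fin 2 × Bool := (0, b)

lemma exists_pos (k : ℤ) : ∃ s h, k = pos s h := by
  rcases le_or_gt k 0 with hk | hk
  · exact ⟨false, (-k).toNat, by simp [pos]; omega⟩
  · exact ⟨true, (k - 1).toNat, by simp [pos]; omega⟩

lemma pos_inj {s s' : Bool} {h h' : ℕ} : pos s h = pos s' h' ↔ s = s' ∧ h = h' := by
  cases s <;> cases s' <;> simp [pos] <;> omega

lemma evalWord_nil : ev [] = 1 := rfl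

lemma evalWord_append (u v : List (Fin 2 × Bool)) : ev (u ++ v) = ev u * ev v := by
  simp [evalWord]

lemma evalWord_cons (a : Fin 2 × Bool) (v : List (Fin 2 × Bool)) :
    ev (a :: v) = letter a * ev v :=
  List.prod_cons

lemma letter_shift (s : Bool) (k : ℤ) : letter (shift s) k = if s then k + 1 else k - 1 := by
  cases s
  · simp [letter, H2gen, Equiv.Perm.inv_def, sub_eq_add_neg]
  · simp [letter, H2gen]

lemma letter_flip (b : Bool) (k : ℤ) :
    letter (flip b) k = if k = 0 then 1 else if k = 1 then 0 else k := by
  cases b <;> simp [letter, H2gen, Equiv.swap_apply_def]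

lemma shift_pos (s : Bool) (h : ℕ) : letter (shift s) (pos s h) = pos s (h + 1) := by
  cases s <;> simp [letter_shift, pos] <;> lia

lemma shift_not_pos_succ (s : Bool) (h : ℕ) : letter (shift !s) (pos s (h + 1)) = pos s h := by
  cases s <;> simp [letter_shift, pos, add_comm]

lemma shift_not_pos_zero (s : Bool) : letter (shift !s) (pos s 0) = pos (!s) 0 := by
  cases s <;> simp [letter_shift, pos]

lemma flip_pos_zero (b s : Bool) : letter (flip b) (pos s 0) = pos (!s) 0 := by
  cases s <;> simp [letter_flip, pos]

lemma flip_pos_succ (b s : Bool) (h : ℕ) : letter (flip b) (pos s (h + 1)) = pos s (h + 1) := by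
  cases s <;> simp [letter_flip, pos] <;> omega

/-- Nonterminals of a grammar for the nontrivial words. -/
inductive NT : Type
  /-- Words moving some point. -/
  | start
  /-- Words moving some point to another point of the same half-line. -/
  | move (s : Bool)
  /-- Words leading from the end of a half-line to some point of it. -/
  | out (s : Bool)
  /-- Words leading from some point of a half-line to its end. -/
  | into (s : Bool)
  /-- Words leading from the end of the half-line `a` to the end of the half-line `b`. -/
  | core (a b : Bool)
  /-- Words fixing all points of a half-line apart from its end. -/
  | loop (s : Bool)

/-- The set of words each nonterminal stands for. -/
def Meaning : NT → List (Fin 2 × Bool) → Prop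
  | .start, w => ev w ≠ 1
  | .move s, w => ∃ h h', h ≠ h' ∧ ev w (pos s h) = pos s h'
  | .out s, w => ∃ h, ev w (pos s 0) = pos s h
  | .into s, w => ∃ h, ev w (pos s h) = pos s 0
  | .core a b, w => ev w (pos a 0) = pos b 0
  | .loop s, w => ∀ h, ev w (pos s (h + 1)) = pos s (h + 1)

local notation "⟪" A "⟫" => Symbol.nonterminal A
local notation "‹" a "›" => Symbol.terminal a

/-- The rules of the grammar; `s`, `b` and `c` range over all booleans. -/
def ruleList (s b c : Bool) : List (ContextFreeRule (Fin 2 × Bool) NT) :=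
  [⟨.start, [⟪.move s⟫]⟩,
   ⟨.start, [⟪.out !s⟫, ⟪.core s !s⟫, ⟪.into s⟫]⟩,
   ⟨.move s, [⟪.loop s⟫, ‹shift s›, ⟪.move s⟫, ‹shift !s›, ⟪.loop s⟫]⟩,
   ⟨.move s, [⟪.loop s⟫, ‹shift s›, ⟪.out s⟫, ⟪.core s s⟫]⟩,
   ⟨.move s, [⟪.core s s⟫, ⟪.into s⟫, ‹shift !s›, ⟪.loop s⟫]⟩,
   ⟨.out s, []⟩,
   ⟨.out s, [⟪.loop s⟫, ‹shift s›, ⟪.out s⟫]⟩,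
   ⟨.into s, []⟩,
   ⟨.into s, [⟪.into s⟫, ‹shift !s›, ⟪.loop s⟫]⟩,
   ⟨.core s b, [⟪.core c b⟫, ⟪.core s c⟫]⟩,
   ⟨.core s s, []⟩,
   ⟨.core s s, [‹shift !s›, ⟪.loop s⟫, ‹shift s›]⟩,
   ⟨.core s !s, [‹flip b›]⟩,
   ⟨.core s !s, [‹shift !s›]⟩,
   ⟨.loop s, []⟩,
   ⟨.loop s, [‹flip b›]⟩,
   ⟨.loop s, [⟪.loop s⟫, ⟪.loop s⟫]⟩,
   ⟨.loop s, [‹shift !s›, ⟪.loop s⟫, ‹shift s›]⟩]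

open Classical in
/-- A grammar for the nontrivial words. -/
noncomputable def grammar : ContextFreeGrammar (Fin 2 × Bool) where
  NT := NT
  initial := .start
  rules := Finset.univ.biUnion fun x : Bool × Bool × Bool => (ruleList x.1 x.2.1 x.2.2).toFinset

lemma mem_rules {r : ContextFreeRule (Fin 2 × Bool) NT} :
    r ∈ grammar.rules ↔ ∃ s b c, r ∈ ruleList s b c := by
  classical
  refine Finset.mem_biUnion.trans ?_
  simp only [Finset.mem_univ, true_and, List.mem_toFinset, Prod.exists]

lemma meaning_of_fills (r : ContextFreeRule (Fin 2 × Bool) NT) (hr : r ∈ grammar.rules)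
    (w : List (Fin 2 × Bool)) (hw : Fills Meaning r.output w) : Meaning r.input w := by
  obtain ⟨s, b, c, hs⟩ := mem_rules.1 hr
  clear hr
  revert w
  revert r
  change ∀ r ∈ ruleList s b c, ∀ w, Fills Meaning r.output w → Meaning r.input w
  simp only [ruleList, List.forall_mem_cons, Fills, Meaning]
  refine ⟨?_, ?_, ?_, ?_, ?_, ?_, ?_, ?_, ?_, ?_, ?_, ?_, ?_, ?_, ?_, ?_, ?_, ?_, by simp⟩
  · rintro _ ⟨u, _, rfl, ⟨h, h', hne, hu⟩, rfl⟩ h1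
    rw [List.append_nil] at h1
    simp [h1, pos_inj, hne] at hu
  · rintro _ ⟨u, _, rfl, ⟨h, hu⟩, v, _, rfl, hv, x, _, rfl, ⟨h', hx⟩, rfl⟩ h1
    have h2 := congrArg (fun f : Equiv.Perm ℤ => f (pos s h')) h1
    simp [evalWord_append, hx, hv, hu, pos_inj] at h2
  · rintro _ ⟨u, _, rfl, hu, _, rfl, v, _, rfl, ⟨h, h', hne, hv⟩, _, rfl, x, _, rfl, hx, rfl⟩
    refine ⟨h + 1, h' + 1, by simpa using hne, ?_⟩
    simp only [evalWord_append, evalWord_nil, evalWord_cons, Equiv.Perm.mul_apply, hx,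
      shift_not_pos_succ, hv, shift_pos, hu, Equiv.Perm.one_apply]
  · rintro _ ⟨u, _, rfl, hu, _, rfl, v, _, rfl, ⟨h, hv⟩, x, _, rfl, hx, rfl⟩
    refine ⟨0, h + 1, by simp, ?_⟩
    simp only [evalWord_append, evalWord_nil, evalWord_cons, Equiv.Perm.mul_apply, hx,
      hv, shift_pos, hu, Equiv.Perm.one_apply]
  · rintro _ ⟨u, _, rfl, hu, v, _, rfl, ⟨h, hv⟩, _, rfl, x, _, rfl, hx, rfl⟩
    refine ⟨h + 1, 0, by simp, ?_⟩
    simp only [evalWord_append, evalWord_nil, evalWord_cons, Equiv.Perm.mul_apply, hx,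
      shift_not_pos_succ, hv, hu, Equiv.Perm.one_apply]
  · rintro _ rfl
    exact ⟨0, rfl⟩
  · rintro _ ⟨u, _, rfl, hu, _, rfl, v, _, rfl, ⟨h, hv⟩, rfl⟩
    refine ⟨h + 1, ?_⟩
    simp only [evalWord_append, evalWord_nil, evalWord_cons, Equiv.Perm.mul_apply,
      hv, shift_pos, hu, Equiv.Perm.one_apply]
  · rintro _ rfl
    exact ⟨0, rfl⟩
  · rintro _ ⟨u, _, rfl, ⟨h, hu⟩, _, rfl, v, _, rfl, hv, rfl⟩
    refine ⟨h + 1, ?_⟩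
    simp only [evalWord_append, evalWord_nil, evalWord_cons, Equiv.Perm.mul_apply,
      hv, shift_not_pos_succ, hu, Equiv.Perm.one_apply]
  · rintro _ ⟨u, _, rfl, hu, v, _, rfl, hv, rfl⟩
    simp [evalWord_append, hu, hv]
  · rintro _ rfl
    rfl
  · rintro _ ⟨_, rfl, u, _, rfl, hu, _, rfl, rfl⟩
    simp only [evalWord_append, evalWord_nil, evalWord_cons, Equiv.Perm.mul_apply,
      shift_pos, hu, shift_not_pos_succ, Equiv.Perm.one_apply]
  · rintro _ ⟨_, rfl, rfl⟩
    exact flip_pos_zero b s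
  · rintro _ ⟨_, rfl, rfl⟩
    exact shift_not_pos_zero s
  · rintro _ rfl h
    rfl
  · rintro _ ⟨_, rfl, rfl⟩ h
    exact flip_pos_succ b s h
  · rintro _ ⟨u, _, rfl, hu, v, _, rfl, hv, rfl⟩ h
    simp [evalWord_append, hu, hv]
  · rintro _ ⟨_, rfl, u, _, rfl, hu, _, rfl, rfl⟩ h
    simp only [evalWord_append, evalWord_nil, evalWord_cons, Equiv.Perm.mul_apply,
      shift_pos, hu, shift_not_pos_succ, Equiv.Perm.one_apply]

/-- Derivability in `grammar`. -/
abbrev Gen (A : NT) (w : List (Fin 2 × Bool)) : Prop := grammar.DerivesWord A w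

lemma gen_of_fills (s b c : Bool) {A : NT} {o : List (Symbol (Fin 2 × Bool) NT)}
    (hr : ⟨A, o⟩ ∈ ruleList s b c) {w : List (Fin 2 × Bool)} (h : Fills Gen o w) : Gen A w :=
  derivesWord_of_fills (g := grammar) (mem_rules.2 ⟨s, b, c, hr⟩) h

variable {u v w x : List (Fin 2 × Bool)} {s a b c : Bool}

lemma gen_loop_nil : Gen (.loop s) [] :=
  gen_of_fills s s s (o := []) (by simp [ruleList]) rfl

lemma gen_loop_flip : Gen (.loop s) [flip b] :=
  gen_of_fills s b s (o := [‹flip b›]) (by simp [ruleList]) ⟨[], rfl, rfl⟩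

lemma gen_loop_append (hu : Gen (.loop s) u) (hv : Gen (.loop s) v) : Gen (.loop s) (u ++ v) :=
  gen_of_fills s s s (o := [⟪.loop s⟫, ⟪.loop s⟫]) (by simp [ruleList])
    ⟨u, v, rfl, hu, v, [], by simp, hv, rfl⟩

lemma gen_loop_conj (hu : Gen (.loop s) u) : Gen (.loop s) (shift (!s) :: (u ++ [shift s])) :=
  gen_of_fills s s s (o := [‹shift !s›, ⟪.loop s⟫, ‹shift s›]) (by simp [ruleList])
    ⟨_, rfl, u, [shift s], rfl, hu, [], rfl, rfl⟩

lemma gen_core_nil : Gen (.core s s) [] :=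
  gen_of_fills s s s (o := []) (by simp [ruleList]) rfl

lemma gen_core_flip : Gen (.core s !s) [flip b] :=
  gen_of_fills s b s (o := [‹flip b›]) (by simp [ruleList]) ⟨[], rfl, rfl⟩

lemma gen_core_shift : Gen (.core s !s) [shift !s] :=
  gen_of_fills s s s (o := [‹shift !s›]) (by simp [ruleList]) ⟨[], rfl, rfl⟩

lemma gen_core_append (hu : Gen (.core c b) u) (hv : Gen (.core a c) v) :
    Gen (.core a b) (u ++ v) :=
  gen_of_fills a b c (o := [⟪.core c b⟫, ⟪.core a c⟫]) (by simp [ruleList])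
    ⟨u, v, rfl, hu, v, [], by simp, hv, rfl⟩

lemma gen_core_conj (hu : Gen (.loop s) u) : Gen (.core s s) (shift (!s) :: (u ++ [shift s])) :=
  gen_of_fills s s s (o := [‹shift !s›, ⟪.loop s⟫, ‹shift s›]) (by simp [ruleList])
    ⟨_, rfl, u, [shift s], rfl, hu, [], rfl, rfl⟩

/-- Words climbing from the end of the half-line `s` to height `h`, factored at the last visits
to the intermediate heights. -/
inductive Climb (s : Bool) : ℕ → List (Fin 2 × Bool) → Prop
  | nil : Climb s 0 []
  | step {h : ℕ} {u v : List (Fin 2 × Bool)} (hu : Gen (.loop s) u) (hv : Climb s h v) :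
    Climb s (h + 1) (u ++ shift s :: v)

/-- Words descending from height `h` to the end of the half-line `s`, factored at the first visits
to the intermediate heights. -/
inductive Descend (s : Bool) : ℕ → List (Fin 2 × Bool) → Prop
  | nil : Descend s 0 []
  | step {h : ℕ} {u v : List (Fin 2 × Bool)} (hu : Gen (.loop s) u) (hv : Descend s h v) :
    Descend s (h + 1) (v ++ shift (!s) :: u)

lemma Climb.gen_out {h : ℕ} (hu : Climb s h u) : Gen (.out s) u := by
  induction hu with
  | nil => exact gen_of_fills s s s (o := []) (by simp [ruleList]) rfl
  | @step _ u v hu _ ih =>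
    exact gen_of_fills s s s (o := [⟪.loop s⟫, ‹shift s›, ⟪.out s⟫]) (by simp [ruleList])
      ⟨u, _, rfl, hu, v, rfl, v, [], by simp, ih, rfl⟩

lemma Descend.gen_into {h : ℕ} (hu : Descend s h u) : Gen (.into s) u := by
  induction hu with
  | nil => exact gen_of_fills s s s (o := []) (by simp [ruleList]) rfl
  | @step _ u v hu _ ih =>
    exact gen_of_fills s s s (o := [⟪.into s⟫, ‹shift !s›, ⟪.loop s⟫]) (by simp [ruleList])
      ⟨v, _, rfl, ih, u, rfl, u, [], by simp, hu, rfl⟩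

lemma Climb.gen_move {h h' : ℕ} (hu : Climb s h' u) (hx : Gen (.core s s) x)
    (hv : Descend s h v) (hne : h ≠ h') : Gen (.move s) (u ++ (x ++ v)) := by
  induction hu generalizing h v with
  | nil =>
    cases hv with
    | nil => exact absurd rfl hne
    | @step _ y z hy hz =>
      exact gen_of_fills s s s (o := [⟪.core s s⟫, ⟪.into s⟫, ‹shift !s›, ⟪.loop s⟫])
        (by simp [ruleList])
        ⟨x, _, rfl, hx, z, _, rfl, hz.gen_into, y, rfl, y, [], by simp, hy, rfl⟩
  | @step _ y z hy hz ih =>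
    cases hv with
    | nil =>
      exact gen_of_fills s s s (o := [⟪.loop s⟫, ‹shift s›, ⟪.out s⟫, ⟪.core s s⟫])
        (by simp [ruleList])
        ⟨y, _, by simp, hy, _, rfl, z, x, rfl, hz.gen_out, x, [], by simp, hx, rfl⟩
    | @step _ y' z' hy' hz' =>
      exact gen_of_fills s s s
        (o := [⟪.loop s⟫, ‹shift s›, ⟪.move s⟫, ‹shift !s›, ⟪.loop s⟫])
        (by simp [ruleList])
        ⟨y, shift s :: ((z ++ (x ++ z')) ++ shift (!s) :: y'), by simp, hy, _, rfl, _, _, rfl,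
          ih hz' (by simpa using hne), y', rfl, y', [], by simp, hy', rfl⟩

/-- A letter either moves up or down the half-line `s` or is a flip. -/
lemma letter_cases (s : Bool) (a : Fin 2 × Bool) :
    a = shift s ∨ a = shift (!s) ∨ ∃ b, a = flip b := by
  revert s a
  decide

lemma exists_climb (c : Bool) (w : List (Fin 2 × Bool)) :
    ∃ s h u x, w = u ++ x ∧ ev w (pos c 0) = pos s h ∧ Climb s h u ∧ Gen (.core c s) x := by
  induction w with
  | nil => exact ⟨c, 0, [], [], rfl, rfl, .nil, gen_core_nil⟩
  | cons l w ih =>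
    obtain ⟨s, h, u, x, rfl, hw, hu, hx⟩ := ih
    rw [evalWord_cons, Equiv.Perm.mul_apply, hw]
    rcases letter_cases s l with rfl | rfl | ⟨b, rfl⟩
    · exact ⟨s, h + 1, shift s :: u, x, rfl, shift_pos s h, .step gen_loop_nil hu, hx⟩
    · cases hu with
      | nil =>
        exact ⟨!s, 0, [], shift (!s) :: x, rfl, shift_not_pos_zero s, .nil,
          gen_core_append (gen_core_shift) hx⟩
      | @step h y z hy hz =>
        cases hz with
        | nil =>
          exact ⟨s, 0, [], (shift (!s) :: (y ++ [shift s])) ++ x, by simp,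
            shift_not_pos_succ s 0, .nil, gen_core_append (gen_core_conj hy) hx⟩
        | @step h y' z' hy' hz' =>
          exact ⟨s, h + 1, (shift (!s) :: (y ++ [shift s]) ++ y') ++ shift s :: z', x, by simp,
            shift_not_pos_succ s _, .step (gen_loop_append (gen_loop_conj hy) hy') hz', hx⟩
    · cases hu with
      | nil =>
        exact ⟨!s, 0, [], flip b :: x, rfl, flip_pos_zero b s, .nil,
          gen_core_append gen_core_flip hx⟩
      | @step h y z hy hz =>
        exact ⟨s, h + 1, ([flip b] ++ y) ++ shift s :: z, x, by simp, flip_pos_succ b s h,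
          .step (gen_loop_append gen_loop_flip hy) hz, hx⟩

lemma exists_descend (c : Bool) (w : List (Fin 2 × Bool)) :
    ∃ s h u x, w = x ++ u ∧ ev w (pos s h) = pos c 0 ∧ Descend s h u ∧ Gen (.core s c) x := by
  induction w using List.reverseRecOn with
  | nil => exact ⟨c, 0, [], [], rfl, rfl, .nil, gen_core_nil⟩
  | append_singleton w l ih =>
    obtain ⟨s, h, u, x, rfl, hw, hu, hx⟩ := ih
    simp only [evalWord_append _ [l], evalWord_cons l [], evalWord_nil, mul_one,
      Equiv.Perm.mul_apply]
    rcases letter_cases s l with rfl | rfl | ⟨b, rfl⟩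
    · cases hu with
      | nil =>
        refine ⟨!s, 0, [], x ++ [shift s], by simp, ?_, .nil, gen_core_append hx ?_⟩
        · have := shift_not_pos_zero (!s)
          rw [Bool.not_not] at this
          rw [this, hw]
        · have := gen_core_shift (s := !s)
          rwa [Bool.not_not] at this
      | @step h y z hy hz =>
        cases hz with
        | nil =>
          refine ⟨s, 0, [], x ++ (shift (!s) :: (y ++ [shift s])), by simp, ?_, .nil,
            gen_core_append hx (gen_core_conj hy)⟩
          rw [shift_pos, hw]
        | @step h y' z' hy' hz' =>
          refine ⟨s, h + 1, z' ++ shift (!s) :: (y' ++ (shift (!s) :: (y ++ [shift s]))), x,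
            by simp, ?_, .step (gen_loop_append hy' (gen_loop_conj hy)) hz', hx⟩
          rw [shift_pos, hw]
    · refine ⟨s, h + 1, u ++ [shift !s], x, by simp, ?_, .step gen_loop_nil hu, hx⟩
      rw [shift_not_pos_succ, hw]
    · cases hu with
      | nil =>
        refine ⟨!s, 0, [], x ++ [flip b], by simp, ?_, .nil, gen_core_append hx ?_⟩
        · rw [flip_pos_zero, Bool.not_not, hw]
        · have := gen_core_flip (s := !s) (b := b)
          rwa [Bool.not_not] at this
      | @step h y z hy hz =>
        refine ⟨s, h + 1, z ++ shift (!s) :: (y ++ [flip b]), x, by simp, ?_,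
          .step (gen_loop_append hy gen_loop_flip) hz, hx⟩
        rw [flip_pos_succ, hw]

/-- A word acts as a translation on the points whose trajectories avoid `0`. -/
lemma exists_translation (w : List (Fin 2 × Bool)) :
    ∃ e : ℤ, ∀ k, (∀ v, v <:+ w → ev v k ≠ 0) → ev w k = k + e := by
  induction w with
  | nil => exact ⟨0, fun k _ => by simp [evalWord_nil]⟩
  | cons l w ih =>
    obtain ⟨e, he⟩ := ih
    have key : ∃ d : ℤ, ∀ x, x ≠ 0 → letter l x ≠ 0 → letter l x = x + d := by
      rcases letter_cases true l with rfl | rfl | ⟨b, rfl⟩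
      · exact ⟨1, fun x _ _ => by simp [letter_shift]⟩
      · exact ⟨-1, fun x _ _ => by simp [letter_shift]; ring⟩
      · refine ⟨0, fun x hx hx' => ?_⟩
        rw [letter_flip] at hx' ⊢
        split_ifs at hx' ⊢ <;> simp_all
    obtain ⟨d, hd⟩ := key
    refine ⟨e + d, fun k hk => ?_⟩
    have hw := he k fun v hv => hk v (hv.trans (List.suffix_cons l w))
    have h0 := hk w (List.suffix_cons l w)
    have h1 := hk _ List.suffix_rfl
    rw [evalWord_cons, Equiv.Perm.mul_apply] at h1 ⊢
    rw [hd _ h0 h1, hw, add_assoc]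

/-- A nontrivial word moves some point whose trajectory passes through `0`. -/
lemma exists_moved_through_zero (hw : ev w ≠ 1) :
    ∃ u v k, w = u ++ v ∧ ev v k = 0 ∧ ev u 0 ≠ k := by
  by_contra! H
  obtain ⟨e, he⟩ := exists_translation w
  have fix : ∀ k, (∃ v, v <:+ w ∧ ev v k = 0) → ev w k = k := by
    rintro k ⟨v, ⟨u, rfl⟩, hv⟩
    rw [evalWord_append, Equiv.Perm.mul_apply, hv, H u v k rfl hv]
  have he0 : e ≠ 0 := by
    rintro rfl
    refine hw (Equiv.ext fun k => ?_)
    by_cases hk : ∃ v, v <:+ w ∧ ev v k = 0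
    · exact fix k hk
    · push Not at hk
      simpa using he k hk
  have back : ∀ k, (∃ v, v <:+ w ∧ ev v k = 0) → ∃ v, v <:+ w ∧ ev v (k - e) = 0 := by
    intro k hk
    by_contra! hk'
    have h := he _ hk'
    rw [sub_add_cancel, ← fix k hk, EmbeddingLike.apply_eq_iff_eq, fix k hk] at h
    omega
  have orbit : ∀ n : ℕ, ∃ v, v <:+ w ∧ ev v (-(n * e)) = 0 := by
    intro n
    induction n with
    | zero => exact ⟨[], List.nil_suffix, by simp [evalWord_nil]⟩
    | succ n ih =>
      have := back _ ih
      rwa [show -((n : ℤ) * e) - e = -((n + 1 : ℕ) * e) by push_cast; ring] at this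
  have hfin : {k : ℤ | ∃ v, v <:+ w ∧ ev v k = 0}.Finite := by
    refine ((w.tails.finite_toSet).image fun v => (ev v)⁻¹ 0).subset ?_
    rintro k ⟨v, hv, hk⟩
    exact ⟨v, (List.mem_tails _ _).2 hv, by simp [← hk]⟩
  refine Set.infinite_of_injective_forall_mem (f := fun n : ℕ => -((n : ℤ) * e)) ?_ orbit hfin
  intro m n hmn
  simpa [he0] using hmn

lemma gen_start (hw : ev w ≠ 1) : Gen .start w := by
  obtain ⟨u, v, k, rfl, hv, hu⟩ := exists_moved_through_zero hw
  obtain ⟨s', h', u, x, rfl, hu', hclimb, hx⟩ := exists_climb false u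
  obtain ⟨s, h, v, y, rfl, hv', hdesc, hy⟩ := exists_descend false v
  have hk : k = pos s h := (ev (y ++ v)).injective (hv.trans hv'.symm)
  have h0 : pos false 0 = 0 := rfl
  rw [← h0, hu', hk, ne_eq, pos_inj] at hu
  have hxy := gen_core_append hx hy
  rw [show u ++ x ++ (y ++ v) = u ++ (x ++ y ++ v) by simp]
  by_cases hs : s' = s
  · subst hs
    refine gen_of_fills s' s' s' (o := [⟪.move s'⟫]) (by simp [ruleList])
      ⟨_, [], by simp, hclimb.gen_move hxy hdesc ?_, rfl⟩
    rintro rfl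
    exact hu ⟨rfl, rfl⟩
  · obtain rfl : s' = !s := Bool.eq_not.2 hs
    exact gen_of_fills s s s (o := [⟪.out !s⟫, ⟪.core s !s⟫, ⟪.into s⟫]) (by simp [ruleList])
      ⟨u, _, rfl, hclimb.gen_out, _, _, rfl, hxy, v, [], by simp, hdesc.gen_into, rfl⟩

end Houghton2

theorem houghton2_coCF :
    Language.IsContextFree
      {w : List (Fin 2 × Bool) | evalWord H2gen w ≠ 1} := by
  refine ⟨Houghton2.grammar, Set.ext fun w => ⟨fun h => ?_, Houghton2.gen_start⟩⟩
  exact ContextFreeGrammar.DerivesWord.induction (I := Houghton2.Meaning)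
    Houghton2.meaning_of_fills h
end

section
/- For every n ≥ 1, the group H(F_n), where F_n = FreeGroup (Fin n) is the free group of rank n, is coCF: there exists a finite subset X of H(F_n) with Subgroup.closure X = H(F_n) such that the language over the alphabet X × Bool consisting of all words whose evaluation in Equiv.Perm (FreeGroup (Fin n)) is not the identity is a context-free language. -/
/-- `H(G) = S_G ⋊ G`: the set of permutations of `G` that agree with a left
translation outside a finite set. -/
def HSet (G : Type*) [Group G] : Set (Equiv.Perm G) :=
  {σ | ∃ g : G, {x : G | σ x ≠ g * x}.Finite}

namespace ContextFreeGrammar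

variable {T : Type*}

/-- `Yields I α w` says that `w` is a concatenation of words obtained from the sentential form `α`
by replacing each nonterminal `A` with some word satisfying `I A`. -/
def Yields {N : Type*} (I : N → List T → Prop) : List (Symbol T N) → List T → Prop
  | [], w => w = []
  | .terminal a :: α, w => ∃ w', w = a :: w' ∧ Yields I α w'
  | .nonterminal A :: α, w => ∃ w₁ w₂, w = w₁ ++ w₂ ∧ I A w₁ ∧ Yields I α w₂

lemma yields_append {N : Type*} {I : N → List T → Prop} {α β : List (Symbol T N)} {w : List T} :
    Yields I (α ++ β) w ↔ ∃ w₁ w₂, w = w₁ ++ w₂ ∧ Yields I α w₁ ∧ Yields I β w₂ := by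
  induction α generalizing w with
  | nil => simp [Yields]
  | cons x α ih =>
    cases x with
    | terminal a =>
      simp only [List.cons_append, Yields, ih]
      constructor
      · rintro ⟨_, rfl, w₁, w₂, rfl, h₁, h₂⟩
        exact ⟨a :: w₁, w₂, rfl, ⟨w₁, rfl, h₁⟩, h₂⟩
      · rintro ⟨_, w₂, rfl, ⟨w₁, rfl, h₁⟩, h₂⟩
        exact ⟨w₁ ++ w₂, rfl, w₁, w₂, rfl, h₁, h₂⟩
    | nonterminal A =>
      simp only [List.cons_append, Yields, ih]
      constructor
      · rintro ⟨w₀, _, rfl, h₀, w₁, w₂, rfl, h₁, h₂⟩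
        exact ⟨w₀ ++ w₁, w₂, by simp, ⟨w₀, w₁, rfl, h₀, h₁⟩, h₂⟩
      · rintro ⟨_, w₂, rfl, ⟨w₀, w₁, rfl, h₀, h₁⟩, h₂⟩
        exact ⟨w₀, w₁ ++ w₂, by simp, h₀, w₁, w₂, rfl, h₁, h₂⟩

lemma yields_map_terminal {N : Type*} (I : N → List T → Prop) (w : List T) :
    Yields I (w.map Symbol.terminal) w := by
  induction w with
  | nil => rfl
  | cons a w ih => exact ⟨w, rfl, ih⟩

variable {g : ContextFreeGrammar T}

lemma Derives.yields {I : g.NT → List T → Prop}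
    (hI : ∀ r ∈ g.rules, ∀ w, Yields I r.output w → I r.input w)
    {α β : List (Symbol T g.NT)} (h : g.Derives α β) {w : List T} (hw : Yields I β w) :
    Yields I α w := by
  induction h with
  | refl => exact hw
  | tail _ hp ih =>
    apply ih
    obtain ⟨r, hr, hrw⟩ := hp
    obtain ⟨p, q, rfl, rfl⟩ := hrw.exists_parts
    rw [yields_append] at hw ⊢
    obtain ⟨w₁, w₂, rfl, h₁, h₂⟩ := hw
    obtain ⟨w₃, w₄, rfl, h₃, h₄⟩ := yields_append.1 h₁
    exact ⟨_, w₂, rfl, yields_append.2 ⟨w₃, w₄, rfl, h₃, w₄, [], by simp, hI r hr _ h₄, rfl⟩, h₂⟩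

lemma interpretation_of_mem_language {I : g.NT → List T → Prop}
    (hI : ∀ r ∈ g.rules, ∀ w, Yields I r.output w → I r.input w)
    {w : List T} (h : w ∈ g.language) : I g.initial w := by
  obtain ⟨w₁, w₂, rfl, h₁, rfl⟩ := Derives.yields hI h (yields_map_terminal I w)
  simpa using h₁

/-- The nonterminal `A` derives the terminal word `w`. -/
def GeneratesFrom (g : ContextFreeGrammar T) (A : g.NT) (w : List T) : Prop :=
  g.Derives [Symbol.nonterminal A] (w.map Symbol.terminal)

lemma Yields.derives {α : List (Symbol T g.NT)} {w : List T}
    (h : Yields g.GeneratesFrom α w) : g.Derives α (w.map Symbol.terminal) := by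
  induction α generalizing w with
  | nil => cases h; exact Derives.refl _
  | cons x α ih =>
    cases x with
    | terminal a =>
      obtain ⟨w', rfl, h⟩ := h
      exact (ih h).append_left [.terminal a]
    | nonterminal A =>
      obtain ⟨w₁, w₂, rfl, h₁, h₂⟩ := h
      rw [List.map_append]
      exact (h₁.append_right α).trans ((ih h₂).append_left _)

lemma generatesFrom_of_rule {A : g.NT} {α : List (Symbol T g.NT)} {w : List T}
    (hr : ⟨A, α⟩ ∈ g.rules) (h : Yields g.GeneratesFrom α w) : g.GeneratesFrom A w :=
  Produces.trans_derives ⟨_, hr, ContextFreeRule.Rewrites.input_output⟩ h.derives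

end ContextFreeGrammar

/-- The effect of a letter on a stack. -/
inductive StackMove (Γ : Type) : Type
  | stay
  | pop
  | push (b : Γ)

/-- Apply a move to a stack. -/
def StackMove.apply {Γ : Type} : StackMove Γ → List Γ → List Γ
  | stay, v => v
  | pop, v => v.tail
  | push b, v => b :: v

/-- A deterministic stack transducer: each letter moves the stack according to a finite class of
the stack, which is computed from the bottom of the stack to its top. -/
structure StackSystem (T Γ K : Type) where
  /-- Class of the empty stack. -/
  base : K
  /-- Class of a stack in terms of its top symbol and the class of the rest. -/
  ext : Γ → K → K
  /-- Move made by a letter on a stack of a given class. -/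
  act : T → K → StackMove Γ
  /-- Symbols that may occur directly above a stack of a given class. -/
  ok : Γ → K → Prop
  act_base : ∀ l, act l base ≠ .pop

namespace StackSystem

open ContextFreeGrammar

variable {T Γ K : Type} (P : StackSystem T Γ K)

/-- Class of a stack. -/
def cl (v : List Γ) : K := v.foldr P.ext P.base

@[simp] lemma cl_nil : P.cl [] = P.base := rfl

@[simp] lemma cl_cons (a : Γ) (v : List Γ) : P.cl (a :: v) = P.ext a (P.cl v) := rfl

/-- Stacks all of whose symbols are admissible. -/
def Valid : List Γ → Prop
  | [] => True
  | a :: v => P.ok a (P.cl v) ∧ Valid v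

/-- The stack after reading a word. -/
def run : List T → List Γ → List Γ
  | [], v => v
  | l :: w, v => run w ((P.act l (P.cl v)).apply v)

@[simp] lemma run_nil (v : List Γ) : P.run [] v = v := rfl

lemma run_cons (l : T) (w : List T) (v : List Γ) :
    P.run (l :: w) v = P.run w ((P.act l (P.cl v)).apply v) := rfl

lemma run_append (w₁ w₂ : List T) (v : List Γ) :
    P.run (w₁ ++ w₂) v = P.run w₂ (P.run w₁ v) := by
  induction w₁ generalizing v with
  | nil => rfl
  | cons l w₁ ih => exact ih _

variable {P} in
lemma Valid.of_append {u v : List Γ} (h : P.Valid (u ++ v)) : P.Valid v := by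
  induction u with
  | nil => exact h
  | cons a u ih => exact ih h.2

/-- Nonterminals of the grammar of words moving some stack: `loop k` stands for the words which
fix every stack of class `k` and never go below it, `up k` for those which lead from a stack of
class `k` to one above it, `down k` for those which lead from above a stack of class `k` to it,
and `dip k` for those which fix a stack of class `k`, possibly going below it. -/
inductive NT (K : Type) : Type
  | start
  | loop (k : K)
  | up (k : K)
  | down (k : K)
  | dip (k : K)

instance [Finite K] : Finite (NT K) := by
  let f : NT K → Option (Fin 4 × K) := fun
    | .start => none
    | .loop k => some (0, k)
    | .up k => some (1, k)
    | .down k => some (2, k)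
    | .dip k => some (3, k)
  apply Finite.of_injective f
  intro a b h
  cases a <;> cases b <;> simp_all [f]

/-- Nonterminal symbols. -/
local notation "ν" => Symbol.nonterminal

/-- Terminal symbols. -/
local notation "τ" => Symbol.terminal

/-- The rules of the grammar of words moving some stack. -/
inductive IsRule : NT K → List (Symbol T (NT K)) → Prop
  | loop_nil (k : K) : IsRule (.loop k) []
  | loop_stay (k : K) (l : T) (h : P.act l k = .stay) : IsRule (.loop k) [ν (.loop k), τ l]
  | loop_push (k : K) (b : Γ) (l l' : T) (h : P.act l k = .push b)
      (h' : P.act l' (P.ext b k) = .pop) :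
      IsRule (.loop k) [ν (.loop k), τ l, ν (.loop (P.ext b k)), τ l']
  | up_loop (k : K) : IsRule (.up k) [ν (.loop k)]
  | up_push (k : K) (b : Γ) (l : T) (h : P.act l k = .push b) :
      IsRule (.up k) [ν (.loop k), τ l, ν (.up (P.ext b k))]
  | down_loop (k : K) : IsRule (.down k) [ν (.loop k)]
  | down_pop (k : K) (b : Γ) (l : T) (hb : P.ok b k) (h : P.act l (P.ext b k) = .pop) :
      IsRule (.down k) [ν (.down (P.ext b k)), τ l, ν (.loop k)]
  | dip_nil (v : List Γ) (hv : P.Valid v) : IsRule (.dip (P.cl v)) []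
  | dip_pop (k : K) (b : Γ) (l l' : T) (hb : P.ok b k) (h : P.act l (P.ext b k) = .pop)
      (h' : P.act l' k = .push b) :
      IsRule (.dip (P.ext b k))
        [ν (.loop (P.ext b k)), τ l, ν (.dip k), ν (.loop k), τ l']
  | start_up (k : K) (b : Γ) (l : T) (h : P.act l k = .push b) :
      IsRule .start [ν (.dip k), ν (.loop k), τ l, ν (.up (P.ext b k))]
  | start_down (k : K) (b : Γ) (l : T) (hb : P.ok b k) (h : P.act l (P.ext b k) = .pop) :
      IsRule .start [ν (.down (P.ext b k)), τ l, ν (.dip k), ν (.loop k)]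
  | start_down_up (k : K) (b c : Γ) (l l' : T) (hbc : b ≠ c) (hb : P.ok b k)
      (h : P.act l (P.ext b k) = .pop) (h' : P.act l' k = .push c) :
      IsRule .start
        [ν (.down (P.ext b k)), τ l, ν (.dip k), ν (.loop k), τ l', ν (.up (P.ext c k))]

lemma finite_setOf_isRule [Finite T] [Finite K] :
    {r : ContextFreeRule T (NT K) | P.IsRule r.input r.output}.Finite := by
  have : Finite (Symbol T (NT K)) := by
    let f : Symbol T (NT K) → T ⊕ NT K := fun
      | .terminal a => .inl a
      | .nonterminal A => .inr A
    apply Finite.of_injective f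
    intro a b h
    cases a <;> cases b <;> simp_all [f]
  have hfin : (Set.univ ×ˢ {α : List (Symbol T (NT K)) | α.length ≤ 6} :
      Set (NT K × List (Symbol T (NT K)))).Finite :=
    Set.finite_univ.prod (List.finite_length_le _ _)
  refine Set.Finite.subset (hfin.image fun p => ⟨p.1, p.2⟩) fun r hr => ?_
  refine ⟨(r.input, r.output), ⟨trivial, ?_⟩, rfl⟩
  obtain ⟨A, α⟩ := r
  change P.IsRule A α at hr
  change α.length ≤ 6
  cases hr <;> simp

/-- The grammar of words moving some valid stack. -/
noncomputable def grammar [Finite T] [Finite K] : ContextFreeGrammar T where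
  NT := NT K
  initial := .start
  rules := P.finite_setOf_isRule.toFinset

/-- The intended meaning of the nonterminals. -/
def Meaning : NT K → List T → Prop
  | .start, w => ∃ v, P.Valid v ∧ P.run w v ≠ v
  | .loop k, w => ∀ v, P.cl v = k → P.run w v = v
  | .up k, w => ∀ v, P.cl v = k → ∃ u, P.run w v = u ++ v
  | .down k, w => ∀ v, P.Valid v → P.cl v = k → ∃ u, P.Valid (u ++ v) ∧ P.run w (u ++ v) = v
  | .dip k, w => ∃ v, P.Valid v ∧ P.cl v = k ∧ P.run w v = v

lemma IsRule.meaning {A : NT K} {α : List (Symbol T (NT K))} (h : P.IsRule A α) {w : List T}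
    (hw : Yields P.Meaning α w) : P.Meaning A w := by
  cases h with
  | loop_nil k => cases hw; exact fun v _ => rfl
  | loop_stay k l h =>
    obtain ⟨w₁, _, rfl, h₁, _, rfl, rfl⟩ := hw
    rintro v rfl
    simp [run_append, h₁ v rfl, run_cons, h, StackMove.apply]
  | loop_push k b l l' h h' =>
    obtain ⟨w₁, _, rfl, h₁, _, rfl, w₂, _, rfl, h₂, _, rfl, rfl⟩ := hw
    rintro v rfl
    simp [run_append, h₁ v rfl, run_cons, h, StackMove.apply, h₂ (b :: v) rfl, h']
  | up_loop k =>
    obtain ⟨w₁, _, rfl, h₁, rfl⟩ := hw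
    rintro v rfl
    exact ⟨[], by simp [h₁ v rfl]⟩
  | up_push k b l h =>
    obtain ⟨w₁, _, rfl, h₁, _, rfl, w₂, _, rfl, h₂, rfl⟩ := hw
    rintro v rfl
    obtain ⟨u, hu⟩ := h₂ (b :: v) rfl
    exact ⟨u ++ [b], by simp [run_append, h₁ v rfl, run_cons, h, StackMove.apply, hu]⟩
  | down_loop k =>
    obtain ⟨w₁, _, rfl, h₁, rfl⟩ := hw
    rintro v hv rfl
    exact ⟨[], hv, by simp [h₁ v rfl]⟩
  | down_pop k b l hb h =>
    obtain ⟨w₁, _, rfl, h₁, _, rfl, w₂, _, rfl, h₂, rfl⟩ := hw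
    rintro v hv rfl
    obtain ⟨u, hu, hu'⟩ := h₁ (b :: v) ⟨hb, hv⟩ rfl
    exact ⟨u ++ [b], by simpa using hu,
      by simp [run_append, hu', run_cons, h, StackMove.apply, h₂ v rfl]⟩
  | dip_nil v hv => cases hw; exact ⟨v, hv, rfl, rfl⟩
  | dip_pop k b l l' hb h h' =>
    obtain ⟨w₁, _, rfl, h₁, _, rfl, w₂, _, rfl, ⟨v, hv, rfl, h₂⟩, w₃, _, rfl, h₃, _, rfl, rfl⟩ := hw
    exact ⟨b :: v, ⟨hb, hv⟩, rfl, by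
      simp [run_append, h₁ (b :: v) rfl, run_cons, h, StackMove.apply, h₂, h₃ v rfl, h']⟩
  | start_up k b l h =>
    obtain ⟨w₁, _, rfl, ⟨v, hv, rfl, h₁⟩, w₂, _, rfl, h₂, _, rfl, w₃, _, rfl, h₃, rfl⟩ := hw
    obtain ⟨u, hu⟩ := h₃ (b :: v) rfl
    refine ⟨v, hv, ?_⟩
    simp only [run_append, h₁, h₂ v rfl, run_cons, h, StackMove.apply, hu, run_nil]
    intro heq
    have := congrArg List.length heq
    simp only [List.length_append, List.length_cons] at this
    omega
  | start_down k b l hb h =>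
    obtain ⟨w₁, _, rfl, h₁, _, rfl, w₂, _, rfl, ⟨v, hv, rfl, h₂⟩, w₃, _, rfl, h₃, rfl⟩ := hw
    obtain ⟨u, hu, hu'⟩ := h₁ (b :: v) ⟨hb, hv⟩ rfl
    refine ⟨_, hu, ?_⟩
    simp only [run_append, hu', run_cons, cl_cons, h, StackMove.apply, List.tail_cons, h₂,
      h₃ v rfl, run_nil]
    intro heq
    have := congrArg List.length heq
    simp only [List.length_append, List.length_cons] at this
    omega
  | start_down_up k b c l l' hbc hb h h' =>
    obtain ⟨w₁, _, rfl, h₁, _, rfl, w₂, _, rfl, ⟨v, hv, rfl, h₂⟩, w₃, _, rfl, h₃, _, rfl,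
      w₄, _, rfl, h₄, rfl⟩ := hw
    obtain ⟨u, hu, hu'⟩ := h₁ (b :: v) ⟨hb, hv⟩ rfl
    obtain ⟨u', hu''⟩ := h₄ (c :: v) rfl
    refine ⟨_, hu, ?_⟩
    simp only [run_append, hu', run_cons, cl_cons, h, StackMove.apply, List.tail_cons, h₂,
      h₃ v rfl, h', hu'', run_nil]
    intro heq
    have : (u' ++ [c]) ++ v = (u ++ [b]) ++ v := by simpa using heq
    have := List.append_cancel_right this
    exact hbc (by simpa using (List.append_inj' this rfl).2.symm)

section Completeness

variable [Finite T] [Finite K]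

/-- The nonterminal `A` derives `w` in the grammar of a stack system. -/
def Gen (A : NT K) (w : List T) : Prop := P.grammar.GeneratesFrom A w

variable {P}

lemma IsRule.gen {A : NT K} {α : List (Symbol T (NT K))} (h : P.IsRule A α) {w : List T}
    (hw : Yields P.Gen α w) : P.Gen A w :=
  generatesFrom_of_rule (g := P.grammar) (P.finite_setOf_isRule.mem_toFinset.2 h) hw

variable (P) in
/-- `P.Down v s w` says that `w` leads from `v` to the stack `s` below it, with the last letter
being the one which pops to `s`. -/
inductive Down (v : List Γ) : List Γ → List T → Prop
  | refl : Down v v []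
  | pop {a : Γ} {s : List Γ} {w d : List T} {l : T} (hw : Down v (a :: s) w)
      (hd : P.Gen (.loop (P.cl (a :: s))) d) (h : P.act l (P.cl (a :: s)) = .pop) :
      Down v s (w ++ d ++ [l])

variable (P) in
/-- `P.Up s z w` says that `w` leads from `s` to the stack `z` above it without going below `s`. -/
inductive Up (s : List Γ) : List Γ → List T → Prop
  | loop {d : List T} (hd : P.Gen (.loop (P.cl s)) d) : Up s s d
  | push {b : Γ} {z : List Γ} {w d : List T} {l : T} (hw : Up s z w)
      (h : P.act l (P.cl z) = .push b) (hd : P.Gen (.loop (P.cl (b :: z))) d) :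
      Up s (b :: z) (w ++ [l] ++ d)

lemma gen_loop_nil (k : K) : P.Gen (.loop k) [] := IsRule.gen (.loop_nil k) rfl

lemma Up.append {s z : List Γ} {w e : List T} (h : P.Up s z w)
    (he : ∀ d, P.Gen (.loop (P.cl z)) d → P.Gen (.loop (P.cl z)) (d ++ e)) :
    P.Up s z (w ++ e) := by
  cases h with
  | loop hd => exact .loop (he _ hd)
  | push hw h hd =>
    rw [List.append_assoc]
    exact .push hw h (he _ hd)

lemma exists_down_up (v : List Γ) (w : List T) :
    ∃ s w₁ w₂, w = w₁ ++ w₂ ∧ P.Down v s w₁ ∧ P.Up s (P.run w v) w₂ := by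
  induction w using List.reverseRecOn with
  | nil => exact ⟨v, [], [], rfl, .refl, .loop (gen_loop_nil _)⟩
  | append_singleton w l ih =>
    obtain ⟨s, w₁, w₂, rfl, h₁, h₂⟩ := ih
    generalize hz : P.run (w₁ ++ w₂) v = z at h₂
    rw [run_append, hz, run_cons, run_nil]
    cases h : P.act l (P.cl z) with
    | stay =>
      exact ⟨s, w₁, w₂ ++ [l], by simp, h₁, h₂.append fun d hd =>
        IsRule.gen (.loop_stay _ l h) ⟨d, [l], rfl, hd, [], rfl, rfl⟩⟩
    | push b =>
      refine ⟨s, w₁, w₂ ++ [l] ++ [], by simp, h₁, .push h₂ h (gen_loop_nil _)⟩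
    | pop =>
      cases h₂ with
      | loop hd =>
        cases s with
        | nil => exact absurd h (P.act_base l)
        | cons a s =>
          exact ⟨s, w₁ ++ w₂ ++ [l], [], by simp, h₁.pop hd h, .loop (gen_loop_nil _)⟩
      | @push b z w d l' hw h' hd =>
        refine ⟨s, w₁, w ++ ([l'] ++ d ++ [l]), by simp, h₁, hw.append fun d' hd' => ?_⟩
        exact IsRule.gen (.loop_push _ b l' l h' h)
          ⟨d', _, rfl, hd', _, rfl, d, [l], rfl, hd, [], rfl, rfl⟩

lemma Up.cases_bottom {s z : List Γ} {w : List T} (h : P.Up s z w) :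
    (z = s ∧ P.Gen (.loop (P.cl s)) w) ∨
      ∃ b d l w', w = d ++ l :: w' ∧ P.Gen (.loop (P.cl s)) d ∧ P.act l (P.cl s) = .push b ∧
        P.Up (b :: s) z w' := by
  induction h with
  | loop hd => exact .inl ⟨rfl, hd⟩
  | @push b z w d l hw h hd ih =>
    right
    obtain ⟨rfl, hw⟩ | ⟨b', d', l', w', rfl, hd', h', hu⟩ := ih
    · exact ⟨b, w, l, d, by simp, hw, h, .loop hd⟩
    · exact ⟨b', d', l', w' ++ [l] ++ d, by simp, hd', h', .push hu h hd⟩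

lemma Up.gen {s z : List Γ} {w : List T} (h : P.Up s z w) : P.Gen (.up (P.cl s)) w := by
  induction hn : w.length using Nat.strong_induction_on generalizing s w with
  | _ n ih =>
    obtain ⟨-, hd⟩ | ⟨b, d, l, w', rfl, hd, hl, hu'⟩ := h.cases_bottom
    · exact IsRule.gen (.up_loop _) ⟨w, [], by simp, hd, rfl⟩
    · refine IsRule.gen (.up_push _ b l hl) ⟨d, _, rfl, hd, w', rfl, w', [], by simp, ?_, rfl⟩
      exact ih w'.length (by simp [← hn]; omega) hu' rfl

lemma Down.suffix {v s : List Γ} {w : List T} (h : P.Down v s w) : ∃ u, v = u ++ s := by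
  induction h with
  | refl => exact ⟨[], rfl⟩
  | @pop a _ _ _ _ _ _ _ ih => obtain ⟨u, rfl⟩ := ih; exact ⟨u ++ [a], by simp⟩

lemma Down.valid {v s : List Γ} {w : List T} (h : P.Down v s w) (hv : P.Valid v) : P.Valid s := by
  obtain ⟨u, rfl⟩ := h.suffix
  exact hv.of_append

lemma Down.gen {v s : List Γ} {w d : List T} (h : P.Down v s w) (hv : P.Valid v)
    (hd : P.Gen (.loop (P.cl s)) d) : P.Gen (.down (P.cl s)) (w ++ d) := by
  induction h generalizing d with
  | refl => exact IsRule.gen (.down_loop _) ⟨d, [], by simp, hd, rfl⟩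
  | @pop a s w d' l hw hd' h ih =>
    exact IsRule.gen (.down_pop _ a l (hw.valid hv).1 h)
      ⟨w ++ d', _, by simp, ih hd', d, rfl, d, [], by simp, hd, rfl⟩

lemma gen_start {v s z : List Γ} {w₁ m w₂ : List T} (hv : P.Valid v) (h₁ : P.Down v s w₁)
    (hm : P.Gen (.dip (P.cl s)) m) (h₂ : P.Up s z w₂) (hz : z ≠ v) :
    P.Gen .start (w₁ ++ m ++ w₂) := by
  induction h₁ generalizing m w₂ with
  | refl =>
    obtain ⟨rfl, -⟩ | ⟨b, d, l, w', rfl, hd, hl, hu⟩ := h₂.cases_bottom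
    · exact absurd rfl hz
    · exact IsRule.gen (.start_up _ b l hl)
        ⟨m, _, rfl, hm, d, _, rfl, hd, w', rfl, w', [], by simp, hu.gen, rfl⟩
  | @pop a s w d l hw hd h ih =>
    have hok := (hw.valid hv).1
    obtain ⟨rfl, hd₂⟩ | ⟨b, d₂, l', w', rfl, hd₂, hl', hu⟩ := h₂.cases_bottom
    · exact IsRule.gen (.start_down _ a l hok h)
        ⟨w ++ d, l :: (m ++ (w₂ ++ [])), by simp, hw.gen hv hd, _, rfl, m, _, rfl, hm, w₂, [], rfl,
          hd₂, rfl⟩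
    · by_cases hab : a = b
      · subst hab
        have hm' : P.Gen (.dip (P.cl (a :: s))) (d ++ (l :: (m ++ (d₂ ++ [l'])))) :=
          IsRule.gen (.dip_pop _ a l l' hok h hl')
            ⟨d, _, rfl, hd, _, rfl, m, _, rfl, hm, d₂, _, rfl, hd₂, _, rfl, rfl⟩
        simpa using ih hm' hu
      · exact IsRule.gen (.start_down_up _ a b l l' hab hok h hl')
          ⟨w ++ d, l :: (m ++ (d₂ ++ l' :: (w' ++ []))), by simp, hw.gen hv hd, _, rfl, m, _, rfl,
            hm, d₂, _, rfl, hd₂, _, rfl, w', [], rfl, hu.gen, rfl⟩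

end Completeness

/-- The words which move some valid stack form a context-free language. -/
theorem isContextFree_moving [Finite T] [Finite K] :
    Language.IsContextFree {w : List T | ∃ v, P.Valid v ∧ P.run w v ≠ v} := by
  refine ⟨P.grammar, Set.ext fun w => ⟨fun h => ?_, ?_⟩⟩
  · exact interpretation_of_mem_language (g := P.grammar) (I := P.Meaning)
      (fun r hr w hw => IsRule.meaning P (P.finite_setOf_isRule.mem_toFinset.1 hr) hw) h
  · rintro ⟨v, hv, hne⟩
    obtain ⟨s, w₁, w₂, rfl, h₁, h₂⟩ := exists_down_up (P := P) v w
    have := gen_start hv h₁ (IsRule.gen (.dip_nil s (h₁.valid hv)) rfl) h₂ hne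
    rwa [List.append_nil] at this

end StackSystem

/-- `HSet G` as a subgroup. -/
def HSubgroup (G : Type*) [Group G] : Subgroup (Equiv.Perm G) where
  carrier := HSet G
  one_mem' := ⟨1, by simp⟩
  mul_mem' := by
    rintro σ τ ⟨g, hg⟩ ⟨h, hh⟩
    refine ⟨g * h, (hh.union (hg.preimage (mul_right_injective h).injOn)).subset fun x hx => ?_⟩
    by_contra hc
    simp only [Set.mem_union, Set.mem_ofPred_eq, Set.mem_preimage, not_or, not_not] at hc
    exact hx (by rw [Equiv.Perm.mul_apply, hc.1, hc.2, mul_assoc])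
  inv_mem' := by
    rintro σ ⟨g, hg⟩
    refine ⟨g⁻¹, (hg.preimage (mul_right_injective g⁻¹).injOn).subset fun x hx => ?_⟩
    intro hc
    apply hx
    rw [Equiv.Perm.inv_eq_iff_eq, hc, mul_inv_cancel_left]

namespace FreeGroup

variable {α : Type*} [DecidableEq α]

open Equiv

/-- Translations by free generators and the transpositions `(1, x)` for free generators `x`. -/
def houghtonGenerators (α : Type*) [DecidableEq α] : Set (Perm (FreeGroup α)) :=
  Set.range (fun i => Equiv.mulLeft (of i)) ∪ Set.range (fun i => swap 1 (of i))

lemma houghtonGenerators_subset : houghtonGenerators α ⊆ HSet (FreeGroup α) := by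
  rintro _ (⟨i, rfl⟩ | ⟨i, rfl⟩)
  · exact ⟨of i, by simp⟩
  · refine ⟨1, (Set.toFinite {1, of i}).subset fun x hx => ?_⟩
    by_contra hc
    simp only [Set.mem_insert_iff, Set.mem_singleton_iff, not_or] at hc
    exact hx (by rw [swap_apply_of_ne_of_ne hc.1 hc.2, one_mul])

lemma mulLeft_mem_and_swap_mem (g : FreeGroup α) :
    Equiv.mulLeft g ∈ Subgroup.closure (houghtonGenerators α) ∧
      swap 1 g ∈ Subgroup.closure (houghtonGenerators α) := by
  set C := Subgroup.closure (houghtonGenerators α)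
  have conj (g x y : FreeGroup α) (hg : Equiv.mulLeft g ∈ C) (h : swap x y ∈ C) :
      swap (g * x) (g * y) ∈ C := by
    have := swap_apply_apply (Equiv.mulLeft g) x y
    rw [coe_mulLeft] at this
    rw [this]
    exact C.mul_mem (C.mul_mem hg h) (C.inv_mem hg)
  induction g using FreeGroup.induction_on with
  | C1 => exact ⟨by rw [mulLeft_one]; exact C.one_mem, by rw [swap_self]; exact C.one_mem⟩
  | of i => exact ⟨Subgroup.subset_closure (.inl ⟨i, rfl⟩), Subgroup.subset_closure (.inr ⟨i, rfl⟩)⟩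
  | inv_of i ih =>
    have h : Equiv.mulLeft (of i)⁻¹ ∈ C := by
      rw [← mulLeft_symm]
      exact C.inv_mem ih.1
    refine ⟨h, ?_⟩
    simpa [swap_comm] using conj _ _ _ h ih.2
  | mul g h hg hh =>
    refine ⟨by rw [mulLeft_mul]; exact C.mul_mem hg.1 hh.1, ?_⟩
    have := conj _ _ _ hg.1 hh.2
    rw [mul_one] at this
    exact SubmonoidClass.swap_mem_trans C hg.2 this

lemma closure_houghtonGenerators :
    (Subgroup.closure (houghtonGenerators α) : Set (Perm (FreeGroup α))) =
      HSet (FreeGroup α) := by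
  apply Set.Subset.antisymm
  · exact (Subgroup.closure_le (HSubgroup (FreeGroup α))).2 houghtonGenerators_subset
  · rintro σ ⟨g, hg⟩
    set C := Subgroup.closure (houghtonGenerators α)
    have hswap (x y : FreeGroup α) : swap x y ∈ C :=
      SubmonoidClass.swap_mem_trans C (swap_comm 1 x ▸ (mulLeft_mem_and_swap_mem x).2)
        (mulLeft_mem_and_swap_mem y).2
    have hfin : (Equiv.mulLeft g)⁻¹ * σ ∈ Subgroup.closure {τ : Perm (FreeGroup α) | τ.IsSwap} := by
      rw [mem_closure_isSwap']
      refine hg.subset fun x hx hc => hx ?_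
      simp [MulAction.mem_fixedBy, hc]
    have hC : (Equiv.mulLeft g)⁻¹ * σ ∈ C := by
      refine (Subgroup.closure_le C).2 ?_ hfin
      rintro _ ⟨x, y, -, rfl⟩
      exact hswap x y
    have := C.mul_mem (mulLeft_mem_and_swap_mem g).1 hC
    rwa [mul_inv_cancel_left] at this

/-- The top two letters of a reduced word determine how generators act on it. -/
abbrev TopTwo (α : Type*) := Option (α × Bool) × Option (α × Bool)

/-- The top two letters of a list. -/
def topTwo (v : List (α × Bool)) : TopTwo α := (v[0]?, v[1]?)

end FreeGroup

open Equiv FreeGroup in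
/-- `τ` acts on reduced words by moving at most one letter at the left end, according to the two
leftmost letters. -/
def IsStackMap {α : Type} [DecidableEq α] (τ : Perm (FreeGroup α)) : Prop :=
  ∃ a : TopTwo α → StackMove (α × Bool), a (none, none) ≠ .pop ∧
    ∀ g, (τ g).toWord = (a (topTwo g.toWord)).apply g.toWord

namespace FreeGroup

open Equiv

variable {α : Type}

section StackMaps

variable [DecidableEq α]

lemma isStackMap_mulLeft_mk (x : α × Bool) : IsStackMap (Equiv.mulLeft (mk [x])) := by
  refine ⟨fun k => if k.1 = some (x.1, !x.2) then .pop else .push x, by simp, fun g => ?_⟩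
  rw [coe_mulLeft, toWord_mul, toWord_mk]
  have : reduce [x] = [x] := rfl
  rw [this, List.singleton_append, reduce.cons, reduce_toWord]
  cases h : g.toWord with
  | nil => simp [topTwo, StackMove.apply]
  | cons y v =>
    obtain ⟨x₁, x₂⟩ := x
    obtain ⟨y₁, y₂⟩ := y
    by_cases hc : x₁ = y₁ ∧ x₂ = !y₂
    · obtain ⟨rfl, rfl⟩ := hc
      simp [topTwo, StackMove.apply]
    · have : ¬ (y₁ = x₁ ∧ y₂ = !x₂) := by
        rintro ⟨rfl, rfl⟩
        simp at hc
      simp [topTwo, StackMove.apply, hc, this]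

lemma isStackMap_swap_one_of (i : α) : IsStackMap (swap 1 (of i)) := by
  refine ⟨fun k => if k = (none, none) then .push (i, true) else
    if k = (some (i, true), none) then .pop else .stay, by simp, fun g => ?_⟩
  by_cases h₁ : g = 1
  · subst h₁
    simp [topTwo, StackMove.apply]
  by_cases h₂ : g = of i
  · subst h₂
    simp [topTwo, StackMove.apply]
  rw [swap_apply_of_ne_of_ne h₁ h₂]
  rw [← toWord_inj] at h₁ h₂
  generalize g.toWord = v at *
  rw [toWord_one] at h₁
  rw [toWord_of] at h₂
  match v with
  | [] => exact absurd rfl h₁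
  | [a] =>
    have : a ≠ (i, true) := by rintro rfl; exact h₂ rfl
    simp [topTwo, this, StackMove.apply]
  | a :: b :: v => simp [topTwo, StackMove.apply]

lemma isStackMap_of_mem {σ : Perm (FreeGroup α)} (h : σ ∈ houghtonGenerators α) :
    IsStackMap σ ∧ IsStackMap σ⁻¹ := by
  obtain ⟨i, rfl⟩ | ⟨i, rfl⟩ := h
  · exact ⟨isStackMap_mulLeft_mk (i, true), isStackMap_mulLeft_mk (i, false)⟩
  · rw [swap_inv]
    exact ⟨isStackMap_swap_one_of i, isStackMap_swap_one_of i⟩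

end StackMaps

/-- The stack system of a family of stack maps on reduced words. -/
def stackSystem {T : Type} (a : T → TopTwo α → StackMove (α × Bool))
    (ha : ∀ l, a l (none, none) ≠ .pop) : StackSystem T (α × Bool) (TopTwo α) where
  base := (none, none)
  ext b k := (some b, k.1)
  act := a
  ok b k := ∀ c, k.1 = some c → b.1 = c.1 → b.2 = c.2
  act_base := ha

variable {T : Type} {a : T → TopTwo α → StackMove (α × Bool)}
  {ha : ∀ l, a l (none, none) ≠ .pop}

lemma stackSystem_cl (v : List (α × Bool)) : (stackSystem a ha).cl v = topTwo v := by
  induction v with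
  | nil => rfl
  | cons b v ih =>
    rw [StackSystem.cl_cons, ih]
    simp [stackSystem, topTwo]

lemma stackSystem_valid_iff (v : List (α × Bool)) :
    (stackSystem a ha).Valid v ↔ IsReduced v := by
  induction v with
  | nil => simp [StackSystem.Valid]
  | cons b v ih =>
    rw [StackSystem.Valid, ih, stackSystem_cl]
    cases v with
    | nil => simp [stackSystem, topTwo]
    | cons c v => simp [stackSystem, topTwo, -Prod.forall]

/-- The non-identity words in a finite alphabet of permutations of a free group, all of which act
as stack maps together with their inverses, form a context-free language. -/
theorem isContextFree_setOf_evalWord_ne_one [DecidableEq α] {A : Type} [Finite A] [Finite α]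
    (f : A → Perm (FreeGroup α)) (hf : ∀ x, IsStackMap (f x) ∧ IsStackMap (f x)⁻¹) :
    Language.IsContextFree {w : List (A × Bool) | evalWord f w ≠ 1} := by
  have hf' (l : A × Bool) : IsStackMap (if l.2 then f l.1 else (f l.1)⁻¹)⁻¹ := by
    split_ifs
    · exact (hf l.1).2
    · rw [inv_inv]
      exact (hf l.1).1
  choose a ha hact using hf'
  let P := stackSystem a ha
  have hrun (w : List (A × Bool)) (g : FreeGroup α) :
      P.run w g.toWord = ((evalWord f w)⁻¹ g).toWord := by
    induction w generalizing g with
    | nil => simp [evalWord]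
    | cons l w ih =>
      rw [StackSystem.run_cons, stackSystem_cl]
      change P.run w ((a l _).apply _) = _
      rw [← hact, ih]
      have : evalWord f (l :: w) = (if l.2 then f l.1 else (f l.1)⁻¹) * evalWord f w := rfl
      rw [this, mul_inv_rev, Perm.mul_apply]
  refine (congrArg Language.IsContextFree (Set.ext fun w => ?_)).mpr P.isContextFree_moving
  change evalWord f w ≠ 1 ↔ ∃ v, P.Valid v ∧ P.run w v ≠ v
  rw [← inv_ne_one, Ne, Equiv.ext_iff, not_forall]
  constructor
  · rintro ⟨g, hg⟩
    refine ⟨g.toWord, (stackSystem_valid_iff _).2 isReduced_toWord, ?_⟩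
    rw [hrun]
    exact fun h => hg (toWord_injective h)
  · rintro ⟨v, hv, hne⟩
    have hv' : (mk v).toWord = v := ((stackSystem_valid_iff _).1 hv).reduce_eq
    refine ⟨mk v, fun h => hne ?_⟩
    rw [← hv', hrun, h]
    rfl

end FreeGroup

theorem HFreeGroup_coCF (n : ℕ) (hn : 1 ≤ n) :
    ∃ X : Finset (Equiv.Perm (FreeGroup (Fin n))),
      (X : Set (Equiv.Perm (FreeGroup (Fin n)))) ⊆ HSet (FreeGroup (Fin n)) ∧
      ((Subgroup.closure (X : Set (Equiv.Perm (FreeGroup (Fin n))))) :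
        Set (Equiv.Perm (FreeGroup (Fin n)))) = HSet (FreeGroup (Fin n)) ∧
      Language.IsContextFree
        {w : List (X × Bool) |
          evalWord (fun x : X => (x : Equiv.Perm (FreeGroup (Fin n)))) w ≠ 1} := by
  classical
  have hX : (FreeGroup.houghtonGenerators (Fin n)).Finite :=
    (Set.finite_range _).union (Set.finite_range _)
  refine ⟨hX.toFinset, ?_, ?_, ?_⟩
  · rw [hX.coe_toFinset]
    exact FreeGroup.houghtonGenerators_subset
  · rw [hX.coe_toFinset]
    exact FreeGroup.closure_houghtonGenerators
  · exact FreeGroup.isContextFree_setOf_evalWord_ne_one _ fun x =>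
      FreeGroup.isStackMap_of_mem (hX.mem_toFinset.1 x.2)
end
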